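/- arXiv:1603.02882 — 4 statements merged into one kernel-verified Lean document; each statement's English description precedes it below -/
import Mathlib

section
/- Let (X, d) be a metric space and let ν, ν₀ be finitely supported probability measures on X. Writing ψ(ν) for the function x ↦ ν({x}), the function ψ(ν) − ψ(ν₀) is a molecule, and W₁(ν, ν₀) = ‖ψ(ν) − ψ(ν₀)‖_Æ, where ‖·‖_Æ is the Arens–Eells norm. -/
open MeasureTheory

/-- The Wasserstein distance of order 1, defined as the infimum of expected distances
over all couplings. -/
noncomputable def W1 {X : Type*} [MetricSpace X] [MeasurableSpace X] (μ ν : Measure X) : ℝ :=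
  sInf {c : ℝ | ∃ π : Measure (X × X), IsProbabilityMeasure π ∧
    π.map Prod.fst = μ ∧ π.map Prod.snd = ν ∧ c = ∫ p, dist p.1 p.2 ∂π}

/-- Membership in the Wasserstein space of order 1: a Borel probability measure with
finite first moment. -/
def MemP1 {X : Type*} [MetricSpace X] [MeasurableSpace X] (x₀ : X) (μ : Measure X) : Prop :=
  IsProbabilityMeasure μ ∧ Integrable (fun x => dist x₀ x) μ

/-- The dual form of the Arens–Eells norm of a finitely supported function:
`‖m‖_Æ = sup { Σ_x f(x) m(x) : f 1-Lipschitz }`. -/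
noncomputable def aeNormDual {X : Type*} [MetricSpace X] (m : X → ℝ) : ℝ :=
  sSup {t : ℝ | ∃ f : X → ℝ, LipschitzWith 1 f ∧ t = ∑ᶠ x, f x * m x}


lemma aux_duality {ι : Type*} [Fintype ι] (a b : ι → ℝ) (ha : ∀ i, 0 ≤ a i)
    (hb : ∀ i, 0 ≤ b i) (sa : ∑ i, a i = 1) (sb : ∑ i, b i = 1) (c : ι → ι → ℝ) (B : ℝ)
    (hB : ∀ u v : ι → ℝ, (∀ i j, u i + v j ≤ c i j) → ∑ i, a i * u i + ∑ j, b j * v j ≤ B) :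
    ∃ P : ι × ι → ℝ, (∀ p, 0 ≤ P p) ∧ (∀ i, ∑ j, P (i, j) = a i) ∧
      (∀ j, ∑ i, P (i, j) = b j) ∧ ∑ p, P p * c p.1 p.2 ≤ B := by
  classical
  let L : (ι × ι → ℝ) →ₗ[ℝ] (ι → ℝ) × (ι → ℝ) × ℝ :=
    { toFun := fun P => (fun i => ∑ j, P (i, j), fun j => ∑ i, P (i, j), ∑ p, P p * c p.1 p.2)
      map_add' := by
        intro P Q
        ext <;> simp [Finset.sum_add_distrib, add_mul]
      map_smul' := by
        intro r P
        ext <;> simp [Finset.mul_sum, mul_assoc] }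
  let T := L '' (stdSimplex ℝ (ι × ι))
  let R : Set ((ι → ℝ) × (ι → ℝ) × ℝ) := {a} ×ˢ ({b} ×ˢ Set.Iic B)
  have hT1 : Convex ℝ T := (convex_stdSimplex ℝ _).linear_image L
  have hT2 : IsCompact T := (isCompact_stdSimplex ℝ _).image L.continuous_of_finiteDimensional
  have hR1 : Convex ℝ R := (convex_singleton a).prod ((convex_singleton b).prod (convex_Iic B))
  have hR2 : IsClosed R := isClosed_singleton.prod (isClosed_singleton.prod isClosed_Iic)
  by_cases hd : Disjoint T R
  · exfalso
    obtain ⟨f, s, t, h1, hst, h2⟩ := geometric_hahn_banach_compact_closed hT1 hT2 hR1 hR2 hd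
    set U : ι → ℝ := fun i => f (Pi.single i 1, 0, 0) with hU
    set V : ι → ℝ := fun i => f (0, Pi.single i 1, 0) with hV
    set l : ℝ := f (0, 0, 1) with hl
    have hf : ∀ x y r, f (x, y, r) = ∑ i, x i * U i + ∑ i, y i * V i + r * l := by
      intro x y r
      have e : (x, y, r) = ∑ i, x i • ((Pi.single i 1, 0, 0) : (ι → ℝ) × (ι → ℝ) × ℝ)
          + ∑ i, y i • ((0, Pi.single i 1, 0) : (ι → ℝ) × (ι → ℝ) × ℝ) 
          + r • ((0, 0, 1) : (ι → ℝ) × (ι → ℝ) × ℝ) := by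
        ext k <;> simp [Prod.fst_sum, Prod.snd_sum, Finset.sum_apply, Pi.single_apply]
      rw [e]
      simp only [map_add, map_sum, map_smul, smul_eq_mul, hU, hV, hl]
    have hpt : ∀ i j, U i + V j + c i j * l < s := by
      intro i j
      have := h1 (L (Pi.single (i, j) 1)) ⟨_, single_mem_stdSimplex ℝ (i, j), rfl⟩
      have e : L (Pi.single (i, j) 1) = (Pi.single i 1, Pi.single j 1, c i j) := by
        ext k
        · simp [L, Pi.single_apply, Prod.ext_iff, ite_and]
        · simp [L, Pi.single_apply, Prod.ext_iff, ite_and]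
        · simp [L, Pi.single_apply]
      rw [e, hf] at this
      simpa [Pi.single_apply] using this
    have hr : ∀ r ≤ B, t < ∑ i, a i * U i + ∑ i, b i * V i + r * l := by
      intro r hr
      rw [← hf]
      exact h2 _ (by simp [R, hr])
    set φ := ∑ i, a i * U i + ∑ i, b i * V i with hφ
    have hl0 : l ≤ 0 := by
      by_contra! h
      have := hr (min B ((t - φ) / l)) (min_le_left _ _)
      have h3 : min B ((t - φ) / l) * l ≤ (t - φ) / l * l :=
        mul_le_mul_of_nonneg_right (min_le_right _ _) h.le
      rw [div_mul_cancel₀ _ h.ne'] at h3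
      linarith
    have hBl := hr B le_rfl
    rcases hl0.lt_or_eq with hneg | hz
    · have := hB (fun i => (s - U i) / l) (fun j => - V j / l) (by
        intro i j
        rw [← add_div, div_le_iff_of_neg hneg]
        linarith [hpt i j])
      have e : ∑ i, a i * ((s - U i) / l) + ∑ j, b j * (- V j / l) = (s - φ) / l := by
        have e1 : ∑ i, a i * ((s - U i) / l) = (s - ∑ i, a i * U i) / l := by
          have e0 : s = ∑ i, a i * s := by rw [← Finset.sum_mul, sa, one_mul]
          have e3 : (s - ∑ i, a i * U i) = ∑ i, (a i * s - a i * U i) := by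
            rw [Finset.sum_sub_distrib, ← e0]
          rw [e3, Finset.sum_div]
          exact Finset.sum_congr rfl fun i _ => by ring
        have e2 : ∑ j, b j * (- V j / l) = (- ∑ j, b j * V j) / l := by
          rw [← Finset.sum_neg_distrib, Finset.sum_div]
          exact Finset.sum_congr rfl fun i _ => by ring
        rw [e1, e2, hφ]; ring
      rw [e, div_le_iff_of_neg hneg] at this
      linarith
    · simp only [hz, mul_zero, add_zero] at hpt hBl
      have h5 : φ ≤ s := by
        have e1 : ∀ i, U i + ∑ j, b j * V j ≤ s := by
          intro i
          have : ∑ j, b j * (U i + V j) ≤ ∑ j, b j * s :=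
            Finset.sum_le_sum fun j _ => mul_le_mul_of_nonneg_left (hpt i j).le (hb j)
          simpa [mul_add, Finset.sum_add_distrib, ← Finset.sum_mul, sb] using this
        have : ∑ i, a i * (U i + ∑ j, b j * V j) ≤ ∑ i, a i * s :=
            Finset.sum_le_sum fun j _ => mul_le_mul_of_nonneg_left (e1 j) (ha j)
        simpa [mul_add, Finset.sum_add_distrib, ← Finset.sum_mul, sa] using this
      linarith
  · rw [Set.not_disjoint_iff] at hd
    obtain ⟨_, ⟨P, hP, rfl⟩, h1, h2, h3⟩ := hd
    exact ⟨P, hP.1, fun i => congrFun h1 i, fun j => congrFun h2 j, h3⟩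

lemma aux_repr {Y : Type*} [MeasurableSpace Y] [MeasurableSingletonClass Y] (μ : Measure Y)
    (S : Finset Y) (h : μ (↑S)ᶜ = 0) :
    μ = ∑ x ∈ S, μ {x} • Measure.dirac x := by
  classical
  ext A hA
  have h1 : μ A = μ (A ∩ S) := by
    refine (measure_inter_conull' ?_).symm
    exact measure_mono_null (fun x hx => hx.2) h
  have h2 : A ∩ S = ↑(S.filter (· ∈ A)) := by
    ext x; simp [and_comm]
  rw [h1, h2, ← sum_measure_singleton, Finset.sum_filter]
  simp [Measure.finsetSum_apply, Set.indicator_apply, hA]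

lemma aux_integrable {Y : Type*} [MeasurableSpace Y] [MeasurableSingletonClass Y] (μ : Measure Y)
    [IsFiniteMeasure μ] (S : Finset Y) (h : μ (↑S)ᶜ = 0) (f : Y → ℝ) : Integrable f μ := by
  rw [aux_repr μ S h, integrable_finsetSum_measure]
  intro x _
  exact (integrable_dirac (by simp)).smul_measure (measure_ne_top _ _)

lemma aux_integral {Y : Type*} [MeasurableSpace Y] [MeasurableSingletonClass Y] (μ : Measure Y)
    [IsFiniteMeasure μ] (S : Finset Y) (h : μ (↑S)ᶜ = 0) (f : Y → ℝ) :
    ∫ x, f x ∂μ = ∑ x ∈ S, f x * (μ {x}).toReal := by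
  conv_lhs => rw [aux_repr μ S h]
  rw [integral_finsetSum_measure]
  · simp [integral_smul_measure, mul_comm]
  · intro x _
    exact (integrable_dirac (by simp)).smul_measure (measure_ne_top _ _)

lemma aux_weak {X : Type*} [MetricSpace X] [MeasurableSpace X] [BorelSpace X]
    (ν ν₀ : Measure X) [IsProbabilityMeasure ν] [IsProbabilityMeasure ν₀] (S : Finset X)
    (hν : ν (↑S)ᶜ = 0) (hν₀ : ν₀ (↑S)ᶜ = 0) (π : Measure (X × X)) [IsProbabilityMeasure π]
    (h1 : π.map Prod.fst = ν) (h2 : π.map Prod.snd = ν₀) (f : X → ℝ) (hf : LipschitzWith 1 f) :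
    ∫ x, f x ∂ν - ∫ x, f x ∂ν₀ ≤ ∫ p, dist p.1 p.2 ∂π := by
  have hπ : π (↑(S ×ˢ S))ᶜ = 0 := by
    have m : MeasurableSet ((S : Set X)ᶜ) := S.measurableSet.compl
    have e1 : π (Prod.fst ⁻¹' (S : Set X)ᶜ) = 0 := by
      rw [← Measure.map_apply measurable_fst m, h1, hν]
    have e2 : π (Prod.snd ⁻¹' (S : Set X)ᶜ) = 0 := by
      rw [← Measure.map_apply measurable_snd m, h2, hν₀]
    refine measure_mono_null ?_ (measure_union_null e1 e2)
    intro p hp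
    simp only [Finset.coe_product, Set.mem_compl_iff, Set.mem_prod, not_and_or] at hp
    exact hp
  have i1 : ∫ x, f x ∂ν = ∫ p, f p.1 ∂π := by
    have := aux_integrable ν S hν f
    rw [← h1] at this ⊢
    exact integral_map measurable_fst.aemeasurable this.1
  have i2 : ∫ x, f x ∂ν₀ = ∫ p, f p.2 ∂π := by
    have := aux_integrable ν₀ S hν₀ f
    rw [← h2] at this ⊢
    exact integral_map measurable_snd.aemeasurable this.1
  rw [i1, i2, ← integral_sub (aux_integrable π _ hπ _) (aux_integrable π _ hπ _)]
  refine integral_mono (aux_integrable π _ hπ _) (aux_integrable π _ hπ _) ?_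
  intro p
  have := hf.dist_le_mul p.1 p.2
  simp only [NNReal.coe_one, one_mul, Real.dist_eq] at this
  exact (le_abs_self _).trans this

lemma aux_ctrans {X : Type*} [MetricSpace X] (S : Finset X) [Nonempty S] (u v : S → ℝ)
    (h : ∀ i j : S, u i + v j ≤ dist (i : X) j) :
    ∃ f : X → ℝ, LipschitzWith 1 f ∧ (∀ i : S, u i ≤ f i) ∧ (∀ j : S, v j ≤ - f j) := by
  let f : X → ℝ := fun x => Finset.univ.inf' Finset.univ_nonempty (fun j : S => dist x j - v j)
  refine ⟨f, LipschitzWith.of_le_add fun x y => ?_, fun i => ?_, fun j => ?_⟩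
  · obtain ⟨j, -, hj⟩ := Finset.exists_mem_eq_inf' (Finset.univ_nonempty (α := S))
      (fun j : S => dist y j - v j)
    have e : f y = dist y j - v j := hj
    have : f x ≤ dist x j - v j := Finset.inf'_le _ (Finset.mem_univ j)
    linarith [dist_triangle x y j]
  · refine Finset.le_inf' _ _ fun j _ => ?_
    linarith [h i j]
  · have : f j ≤ dist (j : X) j - v j := Finset.inf'_le _ (Finset.mem_univ j)
    rw [dist_self] at this
    linarith

/-- For finitely supported probability measures `ν, ν₀`, the function
`ψ(ν) − ψ(ν₀) : x ↦ ν{x} − ν₀{x}` is a molecule and `W₁(ν, ν₀) = ‖ψ(ν) − ψ(ν₀)‖_Æ`. -/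
theorem stmt_9 {X : Type*} [MetricSpace X] [MeasurableSpace X] [BorelSpace X]
    (ν ν₀ : Measure X) [IsProbabilityMeasure ν] [IsProbabilityMeasure ν₀]
    (hν : ∃ s : Finset X, ν (↑s)ᶜ = 0) (hν₀ : ∃ s : Finset X, ν₀ (↑s)ᶜ = 0) :
    (Function.support (fun x => (ν {x}).toReal - (ν₀ {x}).toReal)).Finite ∧
    (∑ᶠ x, ((ν {x}).toReal - (ν₀ {x}).toReal)) = 0 ∧
    W1 ν ν₀ = aeNormDual (fun x => (ν {x}).toReal - (ν₀ {x}).toReal) := by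
  classical
  obtain ⟨s, hs⟩ := hν
  obtain ⟨s₀, hs₀⟩ := hν₀
  obtain ⟨S, hS, hS₀⟩ : ∃ S : Finset X, ν (↑S)ᶜ = 0 ∧ ν₀ (↑S)ᶜ = 0 :=
    ⟨s ∪ s₀, measure_mono_null (Set.compl_subset_compl.2 (by simp)) hs,
      measure_mono_null (Set.compl_subset_compl.2 (by simp)) hs₀⟩
  clear hs hs₀
  have z : ∀ x, x ∉ S → ν {x} = 0 := fun x hx => measure_mono_null (by simpa using hx) hS
  have z₀ : ∀ x, x ∉ S → ν₀ {x} = 0 := fun x hx => measure_mono_null (by simpa using hx) hS₀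
  have hsupp : Function.support (fun x => (ν {x}).toReal - (ν₀ {x}).toReal) ⊆ ↑S := by
    intro x hx
    by_contra h
    exact hx (by simp [z x h, z₀ x h])
  have t1 : ∑ x ∈ S, (ν {x}).toReal = 1 := by
    have := aux_integral ν S hS (fun _ => 1)
    simpa using this.symm
  have t2 : ∑ x ∈ S, (ν₀ {x}).toReal = 1 := by
    have := aux_integral ν₀ S hS₀ (fun _ => 1)
    simpa using this.symm
  have hfs : ∀ f : X → ℝ, ∑ᶠ x, f x * ((ν {x}).toReal - (ν₀ {x}).toReal)
      = ∫ x, f x ∂ν - ∫ x, f x ∂ν₀ := by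
    intro f
    rw [finsum_eq_sum_of_support_subset (s := S), aux_integral ν S hS, aux_integral ν₀ S hS₀,
      ← Finset.sum_sub_distrib]
    · exact Finset.sum_congr rfl fun _ _ => by ring
    · exact (Function.support_mul_subset_right _ _).trans hsupp
  refine ⟨S.finite_toSet.subset hsupp, ?_, ?_⟩
  · rw [finsum_eq_sum_of_support_subset _ hsupp, Finset.sum_sub_distrib, t1, t2, sub_self]
  have hne : Nonempty S := by
    by_contra h
    have : S = ∅ := Finset.isEmpty_coe_sort.1 (not_nonempty_iff.1 h)
    simp [this] at t1
  have hbdd : BddAbove {t : ℝ | ∃ f : X → ℝ, LipschitzWith 1 f ∧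
      t = ∑ᶠ x, f x * ((ν {x}).toReal - (ν₀ {x}).toReal)} := by
    refine ⟨∫ p, dist p.1 p.2 ∂(ν.prod ν₀), ?_⟩
    rintro _ ⟨f, hf, rfl⟩
    rw [hfs]
    exact aux_weak ν ν₀ S hS hS₀ (ν.prod ν₀) (by simp) (by simp) f hf
  apply le_antisymm
  · obtain ⟨P, hP, hr, hc, hcost⟩ := aux_duality (fun i : S => (ν {(i : X)}).toReal)
      (fun i : S => (ν₀ {(i : X)}).toReal) (fun _ => ENNReal.toReal_nonneg)
      (fun _ => ENNReal.toReal_nonneg)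
      (by rw [← t1]; exact Finset.sum_coe_sort S (fun x => (ν {x}).toReal))
      (by rw [← t2]; exact Finset.sum_coe_sort S (fun x => (ν₀ {x}).toReal))
      (fun i j => dist (i : X) j) (aeNormDual (fun x => (ν {x}).toReal - (ν₀ {x}).toReal)) (by
        intro u v huv
        obtain ⟨f, hf, hu, hv⟩ := aux_ctrans S u v huv
        refine le_trans ?_ (le_csSup hbdd ⟨f, hf, rfl⟩)
        rw [hfs, aux_integral ν S hS, aux_integral ν₀ S hS₀, sub_eq_add_neg,
          ← Finset.sum_neg_distrib, ← Finset.sum_coe_sort S, ← Finset.sum_coe_sort S]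
        refine add_le_add (Finset.sum_le_sum fun i _ => ?_) (Finset.sum_le_sum fun i _ => ?_)
        · rw [mul_comm]
          exact mul_le_mul_of_nonneg_right (hu i) ENNReal.toReal_nonneg
        · rw [mul_comm, ← neg_mul]
          exact mul_le_mul_of_nonneg_right (hv i) ENNReal.toReal_nonneg)
    refine le_trans ?_ hcost
    let π : Measure (X × X) := ∑ p : S × S, ENNReal.ofReal (P p) •
      Measure.dirac ((p.1 : X), (p.2 : X))
    have m1 : π.map Prod.fst = ν := by
      ext A hA
      rw [Measure.map_apply measurable_fst hA]
      conv_rhs => rw [aux_repr ν S hS]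
      rw [← Finset.sum_coe_sort S]
      simp only [π, Measure.finsetSum_apply, Measure.smul_apply, smul_eq_mul,
        Measure.dirac_apply' _ hA, Measure.dirac_apply' _ (measurable_fst hA)]
      rw [Fintype.sum_prod_type]
      refine Finset.sum_congr rfl fun i _ => ?_
      have : ν {(i : X)} = ∑ j, ENNReal.ofReal (P (i, j)) := by
        rw [← ENNReal.ofReal_sum_of_nonneg (fun j _ => hP _), hr i,
          ENNReal.ofReal_toReal (measure_ne_top _ _)]
      rw [this, Finset.sum_mul]
      rfl
    have m2 : π.map Prod.snd = ν₀ := by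
      ext A hA
      rw [Measure.map_apply measurable_snd hA]
      conv_rhs => rw [aux_repr ν₀ S hS₀]
      rw [← Finset.sum_coe_sort S]
      simp only [π, Measure.finsetSum_apply, Measure.smul_apply, smul_eq_mul,
        Measure.dirac_apply' _ hA, Measure.dirac_apply' _ (measurable_snd hA)]
      rw [Fintype.sum_prod_type_right]
      refine Finset.sum_congr rfl fun i _ => ?_
      have : ν₀ {(i : X)} = ∑ j, ENNReal.ofReal (P (j, i)) := by
        rw [← ENNReal.ofReal_sum_of_nonneg (fun j _ => hP _), hc i,
          ENNReal.ofReal_toReal (measure_ne_top _ _)]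
      rw [this, Finset.sum_mul]
      rfl
    refine csInf_le ⟨0, ?_⟩ ⟨π, ⟨?_⟩, m1, m2, ?_⟩
    · rintro _ ⟨π, -, -, -, rfl⟩
      exact integral_nonneg fun _ => dist_nonneg
    · have : (π.map Prod.fst) Set.univ = 1 := by rw [m1]; exact measure_univ
      rwa [Measure.map_apply measurable_fst MeasurableSet.univ, Set.preimage_univ] at this
    · rw [integral_finsetSum_measure]
      · refine Finset.sum_congr rfl fun p _ => ?_
        rw [integral_smul_measure, integral_dirac, ENNReal.toReal_ofReal (hP p), smul_eq_mul]
      · intro p _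
        exact (integrable_dirac (by simp)).smul_measure ENNReal.ofReal_ne_top
  · refine csSup_le ⟨_, fun _ => 0, LipschitzWith.const' 0, rfl⟩ ?_
    rintro _ ⟨f, hf, rfl⟩
    refine le_csInf ⟨_, ν.prod ν₀, inferInstance, by simp, by simp, rfl⟩ ?_
    rintro _ ⟨π, hπ, h1, h2, rfl⟩
    rw [hfs]
    exact aux_weak ν ν₀ S hS hS₀ π h1 h2 f hf
end

section
/- Let K be a convex set of finitely supported probability measures on a metric space (X, d), and let ν₀ be a finitely supported probability measure with W₁(ν, ν₀) ≥ ε > 0 for all ν ∈ K. Then there exists a 1-Lipschitz function f : X → ℝ such that ∫ f dν ≥ ∫ f dν₀ + ε for all ν ∈ K. -/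
open MeasureTheory

open scoped ENNReal NNReal

section helpers

set_option linter.unusedSectionVars false

variable {X : Type*} [MetricSpace X] [MeasurableSpace X] [BorelSpace X]

lemma fs_eq (ν : Measure X) (s : Finset X) (h : ν (↑s)ᶜ = 0) :
    ν = ∑ x ∈ s, ν {x} • Measure.dirac x := by
  have h1 : ν.restrict (↑s : Set X) = ν :=
    Measure.restrict_eq_self_of_ae_mem (by rw [ae_iff]; exact h)
  have h2 : (↑s : Set X) = ⋃ x ∈ s, ({x} : Set X) := by ext; simp
  conv_lhs => rw [← h1, h2]
  ext A hA
  rw [Measure.restrict_apply hA, Set.inter_iUnion₂, measure_biUnion_finset]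
  · simp only [Measure.coe_finsetSum, Finset.sum_apply]
    refine Finset.sum_congr rfl fun x _ => ?_
    rw [← Measure.restrict_singleton, Measure.restrict_apply hA]
  · intro x _ y _ hxy
    exact Set.disjoint_of_subset Set.inter_subset_right Set.inter_subset_right (by simpa using hxy)
  · intro x _
    exact hA.inter (measurableSet_singleton x)

lemma fs_integrable (ν : Measure X) [IsFiniteMeasure ν] (s : Finset X) (h : ν (↑s)ᶜ = 0)
    (f : X → ℝ) : Integrable f ν := by
  rw [fs_eq ν s h, integrable_finsetSum_measure]
  intro x _
  exact (integrable_dirac (by simp)).smul_measure (measure_ne_top _ _)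

lemma fs_integral (ν : Measure X) [IsFiniteMeasure ν] (s : Finset X) (h : ν (↑s)ᶜ = 0)
    (f : X → ℝ) : ∫ x, f x ∂ν = ∑ x ∈ s, ν.real {x} * f x := by
  conv_lhs => rw [fs_eq ν s h]
  rw [integral_finsetSum_measure]
  · simp [integral_smul_measure, Measure.real]
  · intro x _
    exact (integrable_dirac (by simp)).smul_measure (measure_ne_top _ _)

lemma fs_part {ι : Type*} [Fintype ι] (ν : Measure X) [IsProbabilityMeasure ν] (t : ℝ≥0)
    (γ : ι → Measure X) (hγ : ∑ y, γ y = (t : ℝ≥0∞) • ν) (i : ι) : γ i ≤ (t : ℝ≥0∞) • ν := by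
  rw [← hγ]
  exact Finset.single_le_sum (f := γ) (fun _ _ => Measure.zero_le _) (Finset.mem_univ i)

lemma fs_part_fin {ι : Type*} [Fintype ι] (ν : Measure X) [IsProbabilityMeasure ν] (t : ℝ≥0)
    (γ : ι → Measure X) (hγ : ∑ y, γ y = (t : ℝ≥0∞) • ν) (i : ι) : IsFiniteMeasure (γ i) := by
  refine ⟨(fs_part ν t γ hγ i Set.univ).trans_lt ?_⟩
  simp

lemma fs_part_null {ι : Type*} [Fintype ι] (ν : Measure X) [IsProbabilityMeasure ν] (t : ℝ≥0)
    (γ : ι → Measure X) (hγ : ∑ y, γ y = (t : ℝ≥0∞) • ν) (i : ι) (s : Finset X)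
    (h : ν (↑s)ᶜ = 0) : γ i (↑s)ᶜ = 0 := by
  have := fs_part ν t γ hγ i (↑s)ᶜ
  simpa [h] using this

/-- The cone predicate. -/
def InS (K : Set (Measure X)) (ν₀ : Measure X) (ε : ℝ) (Y : Finset X) (p : (Y → ℝ) × ℝ) : Prop :=
  ∃ ν ∈ K, ∃ t : ℝ≥0, ∃ s : ℝ, ∃ γ : Y → Measure X, ∑ y, γ y = (t : ℝ≥0∞) • ν ∧
    (∀ y, p.1 y = (γ y).real Set.univ - s * ν₀.real {(y : X)}) ∧
    ∑ y, ∫ x, dist x (y : X) ∂(γ y) - t * ε ≤ p.2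

lemma W1_le (ν ν₀ : Measure X) [IsProbabilityMeasure ν] [IsProbabilityMeasure ν₀]
    (s : Finset X) (hs : ν (↑s)ᶜ = 0) (Y : Finset X) (hY : ν₀ (↑Y)ᶜ = 0)
    (t : ℝ≥0) (ht : t ≠ 0) (γ : Y → Measure X) (hγ : ∑ y, γ y = (t : ℝ≥0∞) • ν)
    (h2 : ∀ y, (γ y) Set.univ = t * ν₀ {(y : X)}) :
    t * W1 ν ν₀ ≤ ∑ y, ∫ x, dist x (y : X) ∂(γ y) := by
  have hfin := fs_part_fin ν t γ hγ
  have hme : ∀ y : X, MeasurableEmbedding (fun x : X => (x, y)) := fun y =>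
    measurableEmbedding_prod_mk_right y
  have ht' : (t : ℝ≥0∞) ≠ 0 := by simpa using ht
  set ρ : Measure (X × X) := ∑ y, (γ y).map (fun x : X => (x, (y : X))) with hρ
  have hfst : ((t : ℝ≥0∞)⁻¹ • ρ).map Prod.fst = ν := by
    rw [Measure.map_smul, hρ, ← Measure.mapₗ_apply_of_measurable measurable_fst, map_sum]
    have : ∀ y : Y, Measure.mapₗ Prod.fst ((γ y).map (fun x : X => (x, (y : X)))) = γ y := by
      intro y
      rw [Measure.mapₗ_apply_of_measurable measurable_fst,
        Measure.map_map measurable_fst (hme y).measurable]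
      exact Measure.map_id
    simp only [this]
    rw [hγ, smul_smul, ENNReal.inv_mul_cancel ht' (by simp), one_smul]
  have hsnd : ((t : ℝ≥0∞)⁻¹ • ρ).map Prod.snd = ν₀ := by
    rw [Measure.map_smul, hρ, ← Measure.mapₗ_apply_of_measurable measurable_snd, map_sum]
    have : ∀ y : Y, Measure.mapₗ Prod.snd ((γ y).map (fun x : X => (x, (y : X))))
        = (t : ℝ≥0∞) • (ν₀ {(y : X)} • Measure.dirac (y : X)) := by
      intro y
      rw [Measure.mapₗ_apply_of_measurable measurable_snd,
        Measure.map_map measurable_snd (hme y).measurable]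
      have : (Prod.snd ∘ fun x : X => (x, (y : X))) = fun _ => (y : X) := rfl
      rw [this, Measure.map_const, h2, smul_smul]
    simp only [this]
    rw [← Finset.smul_sum, smul_smul, ENNReal.inv_mul_cancel ht' (by simp), one_smul]
    conv_rhs => rw [fs_eq ν₀ Y hY]
    exact Finset.sum_coe_sort Y (fun y => ν₀ {y} • Measure.dirac y)
  have hprob : IsProbabilityMeasure ((t : ℝ≥0∞)⁻¹ • ρ) := by
    constructor
    have := congrArg (fun m => m Set.univ) hfst
    simp only [measure_univ] at this
    rwa [Measure.map_apply measurable_fst MeasurableSet.univ, Set.preimage_univ] at this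
  have hcost : ∫ p, dist p.1 p.2 ∂((t : ℝ≥0∞)⁻¹ • ρ)
      = (t : ℝ)⁻¹ * ∑ y, ∫ x, dist x (y : X) ∂(γ y) := by
    rw [integral_smul_measure, hρ, integral_finsetSum_measure]
    · simp only [(hme _).integral_map]
      simp
    · intro y _
      rw [(hme y).integrable_map_iff]
      exact fs_integrable _ s (fs_part_null ν t γ hγ y s hs) _
  have hle : W1 ν ν₀ ≤ (t : ℝ)⁻¹ * ∑ y, ∫ x, dist x (y : X) ∂(γ y) := by
    refine csInf_le ⟨0, ?_⟩ ⟨_, hprob, hfst, hsnd, hcost.symm⟩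
    rintro c ⟨π, _, _, _, rfl⟩
    exact integral_nonneg fun p => dist_nonneg
  have htp : (0 : ℝ) < t := by positivity
  calc (t : ℝ) * W1 ν ν₀ ≤ t * ((t : ℝ)⁻¹ * ∑ y, ∫ x, dist x (y : X) ∂(γ y)) := by gcongr
    _ = _ := by field_simp

lemma InS_zero (K : Set (Measure X)) (ν₀ : Measure X) (ε : ℝ) (Y : Finset X) (hne : K.Nonempty) :
    InS K ν₀ ε Y 0 := by
  obtain ⟨ν, hν⟩ := hne
  exact ⟨ν, hν, 0, 0, 0, by simp, by simp, by simp⟩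

lemma InS_smul (K : Set (Measure X)) (ν₀ : Measure X) (ε : ℝ) (Y : Finset X) (c : ℝ≥0)
    (p : (Y → ℝ) × ℝ) (hp : InS K ν₀ ε Y p) : InS K ν₀ ε Y (c • p) := by
  obtain ⟨ν, hν, t, s, γ, h1, h2, h3⟩ := hp
  refine ⟨ν, hν, c * t, c * s, fun y => (c : ℝ≥0∞) • γ y, ?_, ?_, ?_⟩
  · rw [← Finset.smul_sum, h1, smul_smul]; simp
  · intro y
    simp [h2, NNReal.smul_def]
    ring
  · simp only [integral_smul_measure]
    rw [← Finset.smul_sum]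
    have := mul_le_mul_of_nonneg_left h3 c.2
    simp [NNReal.smul_def] at this ⊢
    linarith

lemma InS_add (K : Set (Measure X))
    (hK : ∀ ν ∈ K, IsProbabilityMeasure ν ∧ ∃ s : Finset X, ν (↑s)ᶜ = 0)
    (hKconv : ∀ μ ∈ K, ∀ ν ∈ K, ∀ t : ℝ, 0 ≤ t → t ≤ 1 →
      (ENNReal.ofReal t) • μ + (ENNReal.ofReal (1 - t)) • ν ∈ K)
    (ν₀ : Measure X) (ε : ℝ) (Y : Finset X)
    (p q : (Y → ℝ) × ℝ) (hp : InS K ν₀ ε Y p) (hq : InS K ν₀ ε Y q) : InS K ν₀ ε Y (p + q) := by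
  obtain ⟨ν, hν, t, s, γ, h1, h2, h3⟩ := hp
  obtain ⟨ν', hν', t', s', γ', h1', h2', h3'⟩ := hq
  obtain ⟨_, F, hF⟩ := hK ν hν
  obtain ⟨_, F', hF'⟩ := hK ν' hν'
  have hfin := fs_part_fin ν t γ h1
  have hfin' := fs_part_fin ν' t' γ' h1'
  have key : ∃ μ ∈ K, (t : ℝ≥0∞) • ν + (t' : ℝ≥0∞) • ν' = ((t + t' : ℝ≥0) : ℝ≥0∞) • μ := by
    by_cases h0 : t + t' = 0
    · have ⟨ha, hb⟩ : t = 0 ∧ t' = 0 := by simpa using h0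
      exact ⟨ν, hν, by simp [ha, hb]⟩
    · have hpos : (0 : ℝ) < t + t' := by
        have : 0 < t + t' := pos_iff_ne_zero.2 h0
        exact_mod_cast this
      have htt : ((t + t' : ℝ≥0) : ℝ≥0∞) = ENNReal.ofReal (t + t') := by
        rw [← NNReal.coe_add, ENNReal.ofReal_coe_nnreal]
      refine ⟨_, hKconv ν hν ν' hν' (t / (t + t')) (by positivity)
        ((div_le_one hpos).2 (by simp)), ?_⟩
      rw [smul_add, smul_smul, smul_smul, htt, ← ENNReal.ofReal_mul hpos.le,
        ← ENNReal.ofReal_mul hpos.le]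
      have e1 : ((t : ℝ) + t') * (t / (t + t')) = t := by field_simp
      have e2 : ((t : ℝ) + t') * (1 - t / (t + t')) = t' := by field_simp; ring
      rw [e1, e2, ENNReal.ofReal_coe_nnreal, ENNReal.ofReal_coe_nnreal]
  obtain ⟨μ, hμ, hμe⟩ := key
  refine ⟨μ, hμ, t + t', s + s', fun y => γ y + γ' y, ?_, ?_, ?_⟩
  · rw [Finset.sum_add_distrib, h1, h1', hμe]
  · intro y
    rw [measureReal_add_apply]
    simp only [Prod.fst_add, Pi.add_apply, h2, h2']
    ring
  · have : ∀ y : Y, ∫ x, dist x (y : X) ∂(γ y + γ' y)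
        = ∫ x, dist x (y : X) ∂(γ y) + ∫ x, dist x (y : X) ∂(γ' y) := fun y =>
      integral_add_measure (fs_integrable _ F (fs_part_null ν t γ h1 y F hF) _)
        (fs_integrable _ F' (fs_part_null ν' t' γ' h1' y F' hF') _)
    simp only [this, Finset.sum_add_distrib, Prod.snd_add, NNReal.coe_add]
    linarith

lemma InS_nonneg (K : Set (Measure X))
    (hK : ∀ ν ∈ K, IsProbabilityMeasure ν ∧ ∃ s : Finset X, ν (↑s)ᶜ = 0)
    (ν₀ : Measure X) [IsProbabilityMeasure ν₀] (ε : ℝ) (Y : Finset X) (hY : ν₀ (↑Y)ᶜ = 0)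
    (hsep : ∀ ν ∈ K, ε ≤ W1 ν ν₀) (c : ℝ) (h : InS K ν₀ ε Y (0, c)) : 0 ≤ c := by
  obtain ⟨ν, hν, t, s, γ, h1, h2, h3⟩ := h
  obtain ⟨_, F, hF⟩ := hK ν hν
  have hfin := fs_part_fin ν t γ h1
  have hsum0 : ∑ y : Y, ν₀.real {(y : X)} = 1 := by
    have := fs_integral ν₀ Y hY (fun _ => 1)
    simp only [integral_const, probReal_univ, mul_one, smul_eq_mul] at this
    rw [this]
    exact Finset.sum_coe_sort Y (fun y => ν₀.real {y})
  have hsum1 : ∑ y : Y, (γ y).real Set.univ = t := by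
    have := congrArg (fun m => (m Set.univ).toReal) h1
    simp only [Measure.coe_finsetSum, Finset.sum_apply, Measure.smul_apply, measure_univ,
      smul_eq_mul, mul_one, ENNReal.coe_toReal] at this
    rw [ENNReal.toReal_sum (fun _ _ => measure_ne_top _ _)] at this
    exact this
  have h2' : ∀ y, (γ y).real Set.univ = s * ν₀.real {(y : X)} := fun y => by
    have := h2 y
    simp only [Pi.zero_apply] at this
    linarith
  have hst : s = t := by
    rw [← hsum1, Finset.sum_congr rfl (fun y _ => h2' y), ← Finset.mul_sum, hsum0, mul_one]
  by_cases ht : t = 0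
  · subst ht
    have : 0 ≤ ∑ y : Y, ∫ x, dist x (y : X) ∂(γ y) :=
      Finset.sum_nonneg fun y _ => integral_nonneg fun x => dist_nonneg
    simp only [NNReal.coe_zero, zero_mul, sub_zero] at h3
    linarith
  · have := W1_le ν ν₀ F hF Y hY t ht γ h1 (fun y => by
      have := h2' y
      rw [hst] at this
      rw [← ENNReal.toReal_eq_toReal_iff' (measure_ne_top _ _)
        (ENNReal.mul_ne_top (by simp) (measure_ne_top _ _))]
      simpa [Measure.real] using this)
    have h4 := mul_le_mul_of_nonneg_left (hsep ν hν) t.2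
    simp only [NNReal.val_eq_coe] at h3 h4
    linarith

lemma InS_dense (K : Set (Measure X))
    (hK : ∀ ν ∈ K, IsProbabilityMeasure ν ∧ ∃ s : Finset X, ν (↑s)ᶜ = 0)
    (ν₀ : Measure X) [IsProbabilityMeasure ν₀] (ε : ℝ)
    (Y : Finset X) (hne : K.Nonempty) (hpos : ∀ y ∈ Y, ν₀ {y} ≠ 0) (b : Y → ℝ) :
    ∃ c, InS K ν₀ ε Y (b, c) := by
  obtain ⟨ν, hν⟩ := hne
  obtain ⟨_, F, hF⟩ := hK ν hν
  set s : ℝ := ∑ y : Y, |b y| / ν₀.real {(y : X)} with hs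
  have hm : ∀ y : Y, 0 < ν₀.real {(y : X)} := fun y =>
    ENNReal.toReal_pos (hpos y y.2) (measure_ne_top _ _)
  have hnn : ∀ y, 0 ≤ b y + s * ν₀.real {(y : X)} := by
    intro y
    have h1 : |b y| / ν₀.real {(y : X)} ≤ s :=
      Finset.single_le_sum (f := fun y : Y => |b y| / ν₀.real {(y : X)})
        (fun z _ => div_nonneg (abs_nonneg _) (hm z).le) (Finset.mem_univ y)
    rw [div_le_iff₀ (hm y)] at h1
    linarith [neg_abs_le (b y)]
  refine ⟨_, ν, hν, ∑ y, (b y + s * ν₀.real {(y : X)}).toNNReal, s,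
    fun y => ENNReal.ofReal (b y + s * ν₀.real {(y : X)}) • ν, ?_, ?_, le_rfl⟩
  · rw [← Finset.sum_smul, ENNReal.ofNNReal_finsetSum]
    rfl
  · intro y
    simp [Measure.real] at hnn ⊢
    rw [ENNReal.toReal_ofReal (hnn _ _)]
    ring

end helpers

/-- Separation theorem for finitely supported probability measures: if `K` is a convex set
of finitely supported probability measures and `ν₀` is a finitely supported probability
measure with `W₁(ν, ν₀) ≥ ε > 0` for all `ν ∈ K`, then there is a 1-Lipschitz `f` with
`∫ f dν ≥ ∫ f dν₀ + ε` for all `ν ∈ K`. -/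
theorem stmt_10 {X : Type*} [MetricSpace X] [MeasurableSpace X] [BorelSpace X]
    (K : Set (Measure X))
    (hK : ∀ ν ∈ K, IsProbabilityMeasure ν ∧ ∃ s : Finset X, ν (↑s)ᶜ = 0)
    (hKconv : ∀ μ ∈ K, ∀ ν ∈ K, ∀ t : ℝ, 0 ≤ t → t ≤ 1 →
      (ENNReal.ofReal t) • μ + (ENNReal.ofReal (1 - t)) • ν ∈ K)
    (ν₀ : Measure X) [IsProbabilityMeasure ν₀] (hν₀ : ∃ s : Finset X, ν₀ (↑s)ᶜ = 0)
    (ε : ℝ) (hε : 0 < ε) (hsep : ∀ ν ∈ K, ε ≤ W1 ν ν₀) :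
    ∃ f : X → ℝ, LipschitzWith 1 f ∧ ∀ ν ∈ K, ∫ x, f x ∂ν₀ + ε ≤ ∫ x, f x ∂ν := by
  classical
  rcases K.eq_empty_or_nonempty with rfl | hne
  · exact ⟨fun _ => 0, LipschitzWith.const' 0 |>.weaken zero_le_one, by simp⟩
  obtain ⟨s₀, hs₀⟩ := hν₀
  obtain ⟨Y, hY, hpos⟩ : ∃ Y : Finset X, ν₀ (↑Y)ᶜ = 0 ∧ ∀ y ∈ Y, ν₀ {y} ≠ 0 := by
    refine ⟨s₀.filter (fun y => ν₀ {y} ≠ 0), ?_, fun y hy => (Finset.mem_filter.1 hy).2⟩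
    refine measure_mono_null (t := (↑s₀)ᶜ ∪ ⋃ y ∈ s₀.filter (fun y => ν₀ {y} = 0), {y}) ?_ ?_
    · intro x hx
      simp at hx ⊢
      tauto
    · refine measure_union_null hs₀ ?_
      refine (measure_biUnion_null_iff (Finset.countable_toSet
        (s₀.filter (fun y => ν₀ {y} = 0)))).2 ?_
      intro y hy
      simpa using (Finset.mem_filter.1 hy).2
  have hYne : Nonempty Y := by
    by_contra hcon
    rw [nonempty_subtype, not_exists] at hcon
    rw [Finset.eq_empty_of_forall_notMem hcon] at hY
    simp at hY
  let S : PointedCone ℝ ((Y → ℝ) × ℝ) :=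
    { carrier := {p | InS K ν₀ ε Y p}
      add_mem' := fun {p q} hp hq => InS_add K hK hKconv ν₀ ε Y p q hp hq
      zero_mem' := InS_zero K ν₀ ε Y hne
      smul_mem' := fun c p hp => InS_smul K ν₀ ε Y ⟨c.1, c.2⟩ p hp }
  let D : ((Y → ℝ) × ℝ) →ₗ.[ℝ] ℝ :=
    { domain := LinearMap.ker (LinearMap.fst ℝ (Y → ℝ) ℝ)
      toFun := (LinearMap.snd ℝ (Y → ℝ) ℝ).domRestrict _ }
  obtain ⟨g, hg1, hg2⟩ := riesz_extension S D (by
      rintro ⟨⟨b, c⟩, hb⟩ h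
      have hb' : b = 0 := hb
      subst hb'
      exact InS_nonneg K hK ν₀ ε Y hY hsep c h) (by
      rintro ⟨b, c⟩
      obtain ⟨c', hc'⟩ := InS_dense K hK ν₀ ε Y hne hpos b
      refine ⟨⟨(0, c' - c), ?_⟩, ?_⟩
      · show (0 : Y → ℝ) = 0
        rfl
      · show InS K ν₀ ε Y ((0, c' - c) + (b, c))
        simpa using hc')
  set L : Y → ℝ := fun y => g (Pi.single y 1, 0) with hL
  have hgsnd : ∀ c : ℝ, g (0, c) = c := fun c => hg1 ⟨(0, c), (rfl : (0 : Y → ℝ) = 0)⟩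
  have hgL : ∀ (b : Y → ℝ) (c : ℝ), g (b, c) = ∑ y, b y * L y + c := by
    intro b c
    have : (b, c) = ∑ y, b y • ((Pi.single y 1, 0) : (Y → ℝ) × ℝ) + (0, c) := by
      ext y
      · simp [Prod.fst_sum, Finset.sum_apply, Pi.single_apply]
      · simp [Prod.snd_sum]
    rw [this, map_add, map_sum, hgsnd]
    simp only [map_smul, smul_eq_mul, hL]
  have hS : ∀ (b : Y → ℝ) (c : ℝ), InS K ν₀ ε Y (b, c) → 0 ≤ ∑ y, b y * L y + c := by
    intro b c h
    rw [← hgL]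
    exact hg2 _ h
  have hm0 : ∑ y : Y, ν₀.real {(y : X)} * L y ≤ 0 := by
    obtain ⟨ν, hν⟩ := hne
    have := hS (fun y => - ν₀.real {(y : X)}) 0 ⟨ν, hν, 0, 1, 0, by simp, by simp, by simp⟩
    simp only [neg_mul, Finset.sum_neg_distrib] at this
    linarith
  have hex : ∀ x : X, ∃ y : Y, ∀ z : Y, L y + dist x y ≤ L z + dist x z := fun x => by
    obtain ⟨y, _, hy⟩ := Finset.exists_min_image Finset.univ (fun z : Y => L z + dist x (z : X))
      Finset.univ_nonempty
    exact ⟨y, fun z => hy z (Finset.mem_univ z)⟩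
  choose yc hyc using hex
  refine ⟨fun x => L (yc x) + dist x (yc x), LipschitzWith.of_le_add fun x x' => ?_, ?_⟩
  · have := hyc x (yc x')
    have := dist_triangle x x' (yc x')
    linarith
  intro ν hν
  obtain ⟨_, F, hF⟩ := hK ν hν
  have hA : ∫ x, (L (yc x) + dist x (yc x)) ∂ν₀ ≤ 0 := by
    rw [fs_integral ν₀ Y hY]
    refine le_trans ?_ hm0
    rw [← Finset.sum_coe_sort Y]
    refine Finset.sum_le_sum fun y _ => ?_
    have := hyc y y
    rw [dist_self, add_zero] at this
    exact mul_le_mul_of_nonneg_left this measureReal_nonneg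
  have hB : ε ≤ ∫ x, (L (yc x) + dist x (yc x)) ∂ν := by
    rw [fs_integral ν F hF]
    let γ : Y → Measure X := fun y => ∑ x ∈ F with yc x = y, ν {x} • Measure.dirac x
    have hγr : ∀ y, (γ y).real Set.univ = ∑ x ∈ F with yc x = y, ν.real {x} := by
      intro y
      simp only [γ, Measure.real, Measure.coe_finsetSum, Finset.sum_apply]
      rw [ENNReal.toReal_sum]
      · simp
      · intro x _
        simp
    have hγi : ∀ y : Y, ∫ x, dist x (y : X) ∂(γ y)
        = ∑ x ∈ F with yc x = y, ν.real {x} * dist x (y : X) := by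
      intro y
      simp only [γ]
      rw [integral_finsetSum_measure]
      · simp [integral_smul_measure, Measure.real]
      · intro x _
        exact (integrable_dirac (by simp)).smul_measure (measure_ne_top _ _)
    have := hS (fun y => (γ y).real Set.univ) (∑ y, ∫ x, dist x (y : X) ∂(γ y) - ε)
      ⟨ν, hν, 1, 0, γ, by
        simp only [γ]
        rw [Finset.sum_fiberwise]
        simpa using (fs_eq ν F hF).symm, by simp, by simp⟩
    simp only [hγr, hγi] at this
    have e : ∑ x ∈ F, ν.real {x} * (L (yc x) + dist x (yc x))
        = ∑ y : Y, (∑ x ∈ F with yc x = y, ν.real {x}) * L y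
          + ∑ y : Y, ∑ x ∈ F with yc x = y, ν.real {x} * dist x (y : X) := by
      rw [← Finset.sum_add_distrib, ← Finset.sum_fiberwise F yc]
      refine Finset.sum_congr rfl fun y _ => ?_
      rw [Finset.sum_mul, ← Finset.sum_add_distrib]
      refine Finset.sum_congr rfl fun x hx => ?_
      rw [(Finset.mem_filter.1 hx).2]
      ring
    linarith
  show ∫ x, (L (yc x) + dist x (yc x)) ∂ν₀ + ε ≤ ∫ x, (L (yc x) + dist x (yc x)) ∂ν
  linarith
end

section
/- Let (X, d) be a Polish space with Wasserstein space (P₁, W₁) of order 1. Let A ⊆ P₁ be convex and closed (in the W₁ topology) and let μ₀ ∈ P₁ with μ₀ ∉ A. Then there exists a Lipschitz function f : X → ℝ such that ∫ f dμ > ∫ f dμ₀ for all μ ∈ A. -/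
open MeasureTheory

open scoped NNReal

lemma W1_le_of_density {X : Type*} [MetricSpace X] [SecondCountableTopology X]
    [MeasurableSpace X] [BorelSpace X] (μ ν : Measure X)
    [IsProbabilityMeasure μ] [IsProbabilityMeasure ν] (W : X × X → ℝ) (hW : Measurable W)
    (hW0 : ∀ p, 0 ≤ W p) (hint : Integrable W (μ.prod ν))
    (h1 : ∀ᵐ x ∂μ, ∫ y, W (x, y) ∂ν = 1) (h2 : ∀ᵐ y ∂ν, ∫ x, W (x, y) ∂μ = 1) :
    W1 μ ν ≤ ∫ p, W p * dist p.1 p.2 ∂(μ.prod ν) := by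
  have hm : Measurable (fun p => ENNReal.ofReal (W p)) := hW.ennreal_ofReal
  set π := (μ.prod ν).withDensity (fun p => ENNReal.ofReal (W p)) with hπ
  have e1 : π.map Prod.fst = μ := by
    ext s hs
    rw [Measure.map_apply measurable_fst hs, hπ, withDensity_apply _ (measurable_fst hs)]
    have : (Prod.fst ⁻¹' s : Set (X × X)) = s ×ˢ Set.univ := by ext; simp
    rw [this, ← Measure.prod_restrict, Measure.restrict_univ, lintegral_prod _ hm.aemeasurable]
    have : ∀ᵐ x ∂(μ.restrict s), ∫⁻ y, ENNReal.ofReal (W (x, y)) ∂ν = 1 := by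
      apply ae_restrict_of_ae
      filter_upwards [h1, hint.prod_right_ae] with x hx hi
      rw [← ofReal_integral_eq_lintegral_ofReal hi (Filter.Eventually.of_forall fun y => hW0 _), hx]
      simp
    rw [lintegral_congr_ae this]
    simp
  have e2 : π.map Prod.snd = ν := by
    ext s hs
    rw [Measure.map_apply measurable_snd hs, hπ, withDensity_apply _ (measurable_snd hs)]
    have : (Prod.snd ⁻¹' s : Set (X × X)) = Set.univ ×ˢ s := by ext; simp
    rw [this, ← Measure.prod_restrict, Measure.restrict_univ,
      lintegral_prod_symm _ hm.aemeasurable]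
    have : ∀ᵐ y ∂(ν.restrict s), ∫⁻ x, ENNReal.ofReal (W (x, y)) ∂μ = 1 := by
      apply ae_restrict_of_ae
      filter_upwards [h2, hint.prod_left_ae] with x hx hi
      rw [← ofReal_integral_eq_lintegral_ofReal hi (Filter.Eventually.of_forall fun y => hW0 _), hx]
      simp
    rw [lintegral_congr_ae this]
    simp
  have hp : IsProbabilityMeasure π := by
    constructor
    have : π.map Prod.fst Set.univ = 1 := by rw [e1]; simp
    rwa [Measure.map_apply measurable_fst MeasurableSet.univ, Set.preimage_univ] at this
  apply csInf_le
  · refine ⟨0, ?_⟩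
    rintro c ⟨π, -, -, -, rfl⟩
    exact integral_nonneg fun p => dist_nonneg
  · refine ⟨π, hp, e1, e2, ?_⟩
    rw [hπ, integral_withDensity_eq_integral_toReal_smul hm (by simp)]
    refine integral_congr_ae (Filter.Eventually.of_forall fun p => ?_)
    simp [ENNReal.toReal_ofReal (hW0 p)]

lemma W1_nonneg {X : Type*} [MetricSpace X] [MeasurableSpace X] (μ ν : Measure X) :
    0 ≤ W1 μ ν := by
  apply Real.sInf_nonneg
  rintro c ⟨π, -, -, -, rfl⟩
  exact integral_nonneg fun p => dist_nonneg

/-- Lipschitz functions are integrable for measures in P1. -/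
lemma lip_integrable {X : Type*} [MetricSpace X] [SecondCountableTopology X]
    [MeasurableSpace X] [BorelSpace X] {x₀ : X} {μ : Measure X} (h : MemP1 x₀ μ)
    {f : X → ℝ} {K : ℝ≥0} (hf : LipschitzWith K f) : Integrable f μ := by
  have := h.1
  refine Integrable.mono' ((integrable_const |f x₀|).add (h.2.const_mul (K : ℝ)))
    hf.continuous.aestronglyMeasurable (Filter.Eventually.of_forall fun x => ?_)
  have := hf.dist_le_mul x x₀
  rw [Real.dist_eq, dist_comm] at this
  have h2 := abs_sub_abs_le_abs_sub (f x) (f x₀)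
  simp only [Pi.add_apply, Real.norm_eq_abs]
  linarith

lemma separate {X : Type*} [MetricSpace X] [TopologicalSpace.SeparableSpace X]
    [MeasurableSpace X] [BorelSpace X] (x₀ : X)
    (A : Set (Measure X)) (hA : ∀ μ ∈ A, MemP1 x₀ μ)
    (hconv : ∀ μ ∈ A, ∀ ν ∈ A, ∀ t : ℝ, 0 ≤ t → t ≤ 1 →
      (ENNReal.ofReal t) • μ + (ENNReal.ofReal (1 - t)) • ν ∈ A)
    (μ₀ : Measure X) (hμ₀ : MemP1 x₀ μ₀)
    {ι : Type} [Fintype ι] (g : ι → X → ℝ) (hg : ∀ i, ∃ K : ℝ≥0, LipschitzWith K (g i))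
    (η : ℝ) (hη : 0 < η)
    (hfar : ∀ μ ∈ A, ¬ ∀ i, |∫ x, g i x ∂μ - ∫ x, g i x ∂μ₀| < η) :
    ∃ (f : X → ℝ) (K : ℝ≥0), LipschitzWith K f ∧
      ∀ μ ∈ A, ∫ x, f x ∂μ₀ < ∫ x, f x ∂μ := by
  classical
  have := UniformSpace.secondCountable_of_separable X
  have hgi : ∀ i, ∀ μ, MemP1 x₀ μ → Integrable (g i) μ := fun i μ h => by
    obtain ⟨K, hK⟩ := hg i
    exact lip_integrable h hK
  let Φ : Measure X → ι → ℝ := fun μ i => ∫ x, g i x ∂μ - ∫ x, g i x ∂μ₀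
  have hc : Convex ℝ (Φ '' A) := by
    rintro _ ⟨μ, hμ, rfl⟩ _ ⟨ν, hν, rfl⟩ a b ha hb hab
    refine ⟨_, hconv μ hμ ν hν a ha (by linarith), ?_⟩
    ext i
    have hb' : 1 - a = b := by linarith
    simp only [Φ, hb', Pi.add_apply, Pi.smul_apply, smul_eq_mul]
    rw [integral_add_measure ((hgi i μ (hA μ hμ)).smul_measure (by simp))
      ((hgi i ν (hA ν hν)).smul_measure (by simp)), integral_smul_measure, integral_smul_measure,
      ENNReal.toReal_ofReal ha, ENNReal.toReal_ofReal hb]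
    simp only [smul_eq_mul]
    have : ∫ x, g i x ∂μ₀ = (a + b) * ∫ x, g i x ∂μ₀ := by rw [hab, one_mul]
    linear_combination -this
  have hd : Disjoint (Metric.ball (0 : ι → ℝ) η) (Φ '' A) := by
    rw [Set.disjoint_left]
    rintro _ hb ⟨μ, hμ, rfl⟩
    apply hfar μ hμ
    intro i
    rw [mem_ball_zero_iff] at hb
    exact lt_of_le_of_lt (norm_le_pi_norm (Φ μ) i) hb
  obtain ⟨L, u, hL1, hL2⟩ := geometric_hahn_banach_open (convex_ball _ _) Metric.isOpen_ball hc hd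
  have hu : 0 < u := by simpa using hL1 0 (by simpa using hη)
  let c : ι → ℝ := fun i => L (Pi.single i 1)
  have hLc : ∀ v : ι → ℝ, L v = ∑ i, c i * v i := by
    intro v
    conv_lhs => rw [pi_eq_sum_univ' v]
    rw [map_sum]
    refine Finset.sum_congr rfl fun i _ => ?_
    rw [map_smul, smul_eq_mul, mul_comm]
  choose K hK using hg
  have hlip : ∀ s : Finset ι, ∃ K : ℝ≥0, LipschitzWith K (fun x => ∑ i ∈ s, c i * g i x) := by
    intro s
    induction s using Finset.induction_on with
    | empty => exact ⟨0, by simp⟩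
    | insert i s his ih =>
      obtain ⟨K', h'⟩ := ih
      simp only [Finset.sum_insert his]
      have h1 : LipschitzWith (‖c i‖₊ * K i) (fun x => c i * g i x) :=
        (lipschitzWith_smul (c i)).comp (hK i)
      exact ⟨_, h1.add h'⟩
  obtain ⟨K', hK'⟩ := hlip Finset.univ
  refine ⟨_, K', hK', fun μ hμ => ?_⟩
  have h1 := hL2 _ ⟨μ, hμ, rfl⟩
  rw [hLc] at h1
  rw [integral_finsetSum _ (fun i _ => (hgi i _ hμ₀).const_mul _),
    integral_finsetSum _ (fun i _ => (hgi i _ (hA μ hμ)).const_mul _)]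
  simp only [integral_const_mul]
  simp only [Φ, mul_sub, Finset.sum_sub_distrib] at h1
  linarith

lemma W1_le_partial {X : Type*} [MetricSpace X] [SecondCountableTopology X]
    [MeasurableSpace X] [BorelSpace X] (x₀ : X) (μ ν : Measure X)
    (hμ : MemP1 x₀ μ) (hν : MemP1 x₀ ν) (N : ℕ) (φ : ℕ → X → ℝ) (z : ℕ → X) (δ : ℝ)
    (hδ : 0 ≤ δ)
    (hφc : ∀ i, Measurable (φ i)) (hφ0 : ∀ i x, 0 ≤ φ i x)
    (hφ1 : ∀ x, ∑ i ∈ Finset.range N, φ i x ≤ 1)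
    (hφz : ∀ i x, φ i x ≠ 0 → dist x (z i) ≤ δ)
    (hφμ : ∀ i, Integrable (φ i) μ) (hφν : ∀ i, Integrable (φ i) ν)
    (a b c : ℕ → ℝ) (ha : ∀ i, a i = ∫ x, φ i x ∂μ) (hb : ∀ i, b i = ∫ x, φ i x ∂ν)
    (hc : ∀ i, c i = (max (a i) (b i))⁻¹) :
    W1 μ ν ≤ 2 * δ + ∫ x, dist x₀ x * (1 - ∑ i ∈ Finset.range N, b i * c i * φ i x) ∂μ
      + ∫ x, dist x₀ x * (1 - ∑ i ∈ Finset.range N, a i * c i * φ i x) ∂ν := by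
  have := hμ.1
  have := hν.1
  have ha0 : ∀ i, 0 ≤ a i := fun i => by rw [ha]; exact integral_nonneg (hφ0 i)
  have hb0 : ∀ i, 0 ≤ b i := fun i => by rw [hb]; exact integral_nonneg (hφ0 i)
  have hc0 : ∀ i, 0 ≤ c i := fun i => by rw [hc]; exact inv_nonneg.2 (le_max_of_le_left (ha0 i))
  have hbc : ∀ i, b i * c i ≤ 1 := fun i => by
    rw [hc, ← div_eq_mul_inv]
    exact div_le_one_of_le₀ (le_max_right _ _) (le_max_of_le_left (ha0 i))
  have hac : ∀ i, a i * c i ≤ 1 := fun i => by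
    rw [hc, ← div_eq_mul_inv]
    exact div_le_one_of_le₀ (le_max_left _ _) (le_max_of_le_left (ha0 i))
  set U : X → ℝ := fun x => 1 - ∑ i ∈ Finset.range N, b i * c i * φ i x with hU
  set V : X → ℝ := fun x => 1 - ∑ i ∈ Finset.range N, a i * c i * φ i x with hV
  have hUm : Measurable U := by fun_prop
  have hVm : Measurable V := by fun_prop
  have hU0 : ∀ x, 0 ≤ U x := fun x => by
    have : ∑ i ∈ Finset.range N, b i * c i * φ i x ≤ ∑ i ∈ Finset.range N, φ i x :=
      Finset.sum_le_sum fun i _ => mul_le_of_le_one_left (hφ0 i x) (hbc i)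
    have := hφ1 x
    simp only [hU]; linarith
  have hV0 : ∀ x, 0 ≤ V x := fun x => by
    have : ∑ i ∈ Finset.range N, a i * c i * φ i x ≤ ∑ i ∈ Finset.range N, φ i x :=
      Finset.sum_le_sum fun i _ => mul_le_of_le_one_left (hφ0 i x) (hac i)
    have := hφ1 x
    simp only [hV]; linarith
  have hU1 : ∀ x, U x ≤ 1 := fun x => by
    have : 0 ≤ ∑ i ∈ Finset.range N, b i * c i * φ i x :=
      Finset.sum_nonneg fun i _ => mul_nonneg (mul_nonneg (hb0 i) (hc0 i)) (hφ0 i x)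
    simp only [hU]; linarith
  have hV1 : ∀ x, V x ≤ 1 := fun x => by
    have : 0 ≤ ∑ i ∈ Finset.range N, a i * c i * φ i x :=
      Finset.sum_nonneg fun i _ => mul_nonneg (mul_nonneg (ha0 i) (hc0 i)) (hφ0 i x)
    simp only [hV]; linarith
  have hUi : Integrable U μ := (integrable_const _).sub
    (integrable_finsetSum _ fun i _ => (hφμ i).const_mul _)
  have hVi : Integrable V ν := (integrable_const _).sub
    (integrable_finsetSum _ fun i _ => (hφν i).const_mul _)
  have hdU : Integrable (fun x => dist x₀ x * U x) μ := by
    refine hμ.2.mono' (by fun_prop) (Filter.Eventually.of_forall fun x => ?_)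
    rw [Real.norm_eq_abs, abs_of_nonneg (mul_nonneg dist_nonneg (hU0 x))]
    exact mul_le_of_le_one_right dist_nonneg (hU1 x)
  have hdV : Integrable (fun x => dist x₀ x * V x) ν := by
    refine hν.2.mono' (by fun_prop) (Filter.Eventually.of_forall fun x => ?_)
    rw [Real.norm_eq_abs, abs_of_nonneg (mul_nonneg dist_nonneg (hV0 x))]
    exact mul_le_of_le_one_right dist_nonneg (hV1 x)
  set m : ℝ := 1 - ∑ i ∈ Finset.range N, a i * b i * c i with hm
  have hUint : ∫ x, U x ∂μ = m := by
    simp only [hU]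
    rw [integral_sub (integrable_const _)
      (integrable_finsetSum _ fun i _ => (hφμ i).const_mul _),
      integral_finsetSum _ (fun i _ => (hφμ i).const_mul _)]
    simp only [integral_const_mul, ← ha, hm, integral_const, probReal_univ, one_smul]
    congr 1
    exact Finset.sum_congr rfl fun i _ => by ring
  have hVint : ∫ x, V x ∂ν = m := by
    simp only [hV]
    rw [integral_sub (integrable_const _)
      (integrable_finsetSum _ fun i _ => (hφν i).const_mul _),
      integral_finsetSum _ (fun i _ => (hφν i).const_mul _)]
    simp only [integral_const_mul, ← hb, hm, integral_const, probReal_univ, one_smul]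
    congr 1
    exact Finset.sum_congr rfl fun i _ => by ring
  have hm0 : 0 ≤ m := hUint ▸ integral_nonneg hU0
  have hUm' : ∀ᵐ x ∂μ, U x * (m⁻¹ * m) = U x := by
    by_cases h : m = 0
    · rw [h, integral_eq_zero_iff_of_nonneg hU0 hUi] at hUint
      filter_upwards [hUint] with x hx
      simp [hx]
    · simp [h]
  have hVm' : ∀ᵐ x ∂ν, V x * (m⁻¹ * m) = V x := by
    by_cases h : m = 0
    · rw [h, integral_eq_zero_iff_of_nonneg hV0 hVi] at hVint
      filter_upwards [hVint] with x hx
      simp [hx]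
    · simp [h]
  have hUI : (∫ x, dist x₀ x * U x ∂μ) * (m⁻¹ * m) = ∫ x, dist x₀ x * U x ∂μ := by
    rw [← integral_mul_const]
    refine integral_congr_ae ?_
    filter_upwards [hUm'] with x hx
    rw [mul_assoc, hx]
  have hVI : (∫ x, dist x₀ x * V x ∂ν) * (m⁻¹ * m) = ∫ x, dist x₀ x * V x ∂ν := by
    rw [← integral_mul_const]
    refine integral_congr_ae ?_
    filter_upwards [hVm'] with x hx
    rw [mul_assoc, hx]
  set W : X × X → ℝ := fun p =>
    ∑ i ∈ Finset.range N, c i * (φ i p.1 * φ i p.2) + m⁻¹ * (U p.1 * V p.2) with hW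
  have hWi : Integrable W (μ.prod ν) :=
    (integrable_finsetSum _ fun i _ => ((hφμ i).mul_prod (hφν i)).const_mul _).add
      ((hUi.mul_prod hVi).const_mul _)
  refine (W1_le_of_density μ ν W (by fun_prop) ?_ hWi ?_ ?_).trans ?_
  · intro p
    exact add_nonneg (Finset.sum_nonneg fun i _ => mul_nonneg (hc0 i)
      (mul_nonneg (hφ0 _ _) (hφ0 _ _))) (mul_nonneg (inv_nonneg.2 hm0) (mul_nonneg (hU0 _) (hV0 _)))
  · filter_upwards [hUm'] with x hx
    simp only [hW]
    rw [integral_add (integrable_finsetSum _ fun i _ => ((hφν i).const_mul _).const_mul _)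
      ((hVi.const_mul _).const_mul _),
      integral_finsetSum _ (fun i _ => ((hφν i).const_mul _).const_mul _)]
    simp only [integral_const_mul, ← hb, hVint]
    have e : ∑ i ∈ Finset.range N, c i * (φ i x * b i) = 1 - U x := by
      simp only [hU, sub_sub_cancel]
      exact Finset.sum_congr rfl fun i _ => by ring
    rw [e]
    linear_combination hx
  · filter_upwards [hVm'] with x hx
    simp only [hW]
    rw [integral_add (integrable_finsetSum _ fun i _ => ((hφμ i).mul_const _).const_mul _)
      ((hUi.mul_const _).const_mul _),
      integral_finsetSum _ (fun i _ => ((hφμ i).mul_const _).const_mul _)]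
    simp only [integral_const_mul, integral_mul_const, ← ha, hUint]
    have e : ∑ i ∈ Finset.range N, c i * (a i * φ i x) = 1 - V x := by
      simp only [hV, sub_sub_cancel]
      exact Finset.sum_congr rfl fun i _ => by ring
    rw [e]
    linear_combination hx
  · have i1 : Integrable (fun p : X × X => ∑ i ∈ Finset.range N,
        (2 * δ * c i) * (φ i p.1 * φ i p.2)) (μ.prod ν) :=
      integrable_finsetSum _ fun i _ => ((hφμ i).mul_prod (hφν i)).const_mul _
    have i2 : Integrable (fun p : X × X => m⁻¹ * ((dist x₀ p.1 * U p.1) * V p.2)) (μ.prod ν) :=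
      (hdU.mul_prod hVi).const_mul _
    have i3 : Integrable (fun p : X × X => m⁻¹ * (U p.1 * (dist x₀ p.2 * V p.2))) (μ.prod ν) :=
      (hUi.mul_prod hdV).const_mul _
    calc ∫ p, W p * dist p.1 p.2 ∂(μ.prod ν)
        ≤ ∫ p : X × X, (∑ i ∈ Finset.range N, (2 * δ * c i) * (φ i p.1 * φ i p.2)
          + m⁻¹ * ((dist x₀ p.1 * U p.1) * V p.2)
          + m⁻¹ * (U p.1 * (dist x₀ p.2 * V p.2))) ∂(μ.prod ν) := by
          refine integral_mono_of_nonneg (Filter.Eventually.of_forall fun p => ?_)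
            ((i1.add i2).add i3) (Filter.Eventually.of_forall fun p => ?_)
          · exact mul_nonneg (add_nonneg (Finset.sum_nonneg fun i _ => mul_nonneg (hc0 i)
              (mul_nonneg (hφ0 _ _) (hφ0 _ _)))
              (mul_nonneg (inv_nonneg.2 hm0) (mul_nonneg (hU0 _) (hV0 _)))) dist_nonneg
          · simp only [hW]
            rw [add_mul, add_assoc, Finset.sum_mul]
            refine add_le_add (Finset.sum_le_sum fun i _ => ?_) ?_
            · by_cases h1 : φ i p.1 = 0
              · simp [h1]
              by_cases h2 : φ i p.2 = 0
              · simp [h2]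
              have hd : dist p.1 p.2 ≤ 2 * δ := by
                have := dist_triangle_right p.1 p.2 (z i)
                have := hφz i _ h1
                have := hφz i _ h2
                linarith
              have := mul_le_mul_of_nonneg_left hd
                (mul_nonneg (hc0 i) (mul_nonneg (hφ0 i p.1) (hφ0 i p.2)))
              linarith
            · have hd : dist p.1 p.2 ≤ dist x₀ p.1 + dist x₀ p.2 := dist_triangle_left _ _ _
              have := mul_le_mul_of_nonneg_left hd
                (mul_nonneg (inv_nonneg.2 hm0) (mul_nonneg (hU0 p.1) (hV0 p.2)))
              linarith
      _ = 2 * δ * (1 - m) + (∫ x, dist x₀ x * U x ∂μ) * (m⁻¹ * m)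
          + (∫ x, dist x₀ x * V x ∂ν) * (m⁻¹ * m) := by
          have e0 := integral_add (i1.add i2) i3
          simp only [Pi.add_apply] at e0
          rw [e0, integral_add i1 i2,
            integral_finsetSum _ (fun i _ => ((hφμ i).mul_prod (hφν i)).const_mul _)]
          simp only [integral_const_mul]
          rw [integral_prod_mul (fun x => dist x₀ x * U x) V,
            integral_prod_mul U (fun x => dist x₀ x * V x), hUint, hVint]
          have e : ∑ i ∈ Finset.range N, 2 * δ * c i * ∫ p : X × X, φ i p.1 * φ i p.2 ∂(μ.prod ν)
              = 2 * δ * (1 - m) := by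
            rw [hm, sub_sub_cancel, Finset.mul_sum]
            refine Finset.sum_congr rfl fun i _ => ?_
            rw [integral_prod_mul (φ i) (φ i), ← ha, ← hb]
            ring
          rw [e]
          ring
      _ ≤ _ := by
          rw [hUI, hVI]
          have := mul_nonneg hδ hm0
          linarith

lemma resid_bound {X : Type*} [MetricSpace X] [SecondCountableTopology X]
    [MeasurableSpace X] [BorelSpace X] (x₀ : X) (μ : Measure X)
    (hμ : MemP1 x₀ μ) (N : ℕ) (φ : ℕ → X → ℝ) (z : ℕ → X) (δ R : ℝ)
    (hφ0 : ∀ i x, 0 ≤ φ i x)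
    (hφ1 : ∀ x, ∑ i ∈ Finset.range N, φ i x ≤ 1)
    (hφz : ∀ i x, φ i x ≠ 0 → dist x (z i) ≤ δ)
    (hφμ : ∀ i, Integrable (φ i) μ)
    (hk : Integrable (fun x => max 0 (dist x₀ x - R)) μ)
    (a α : ℕ → ℝ) (ha : ∀ i, a i = ∫ x, φ i x ∂μ) (hα0 : ∀ i, 0 ≤ α i) (hα : ∀ i, α i ≤ 1) :
    ∫ x, dist x₀ x * (1 - ∑ i ∈ Finset.range N, α i * φ i x) ∂μ ≤
      ∫ x, max 0 (dist x₀ x - R) ∂μ + R * (1 - ∑ i ∈ Finset.range N, a i)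
      + ∑ i ∈ Finset.range N, (dist x₀ (z i) + δ) * (a i - α i * a i) := by
  have := hμ.1
  have i2 : Integrable (fun x => R * (1 - ∑ i ∈ Finset.range N, φ i x)) μ :=
    ((integrable_const _).sub (integrable_finsetSum _ fun i _ => hφμ i)).const_mul _
  have i3 : Integrable (fun x => ∑ i ∈ Finset.range N,
      ((dist x₀ (z i) + δ) * (1 - α i)) * φ i x) μ :=
    integrable_finsetSum _ fun i _ => (hφμ i).const_mul _
  calc _ ≤ ∫ x, (max 0 (dist x₀ x - R) + R * (1 - ∑ i ∈ Finset.range N, φ i x)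
        + ∑ i ∈ Finset.range N, ((dist x₀ (z i) + δ) * (1 - α i)) * φ i x) ∂μ := by
        refine integral_mono_of_nonneg (Filter.Eventually.of_forall fun x => ?_)
          ((hk.add i2).add i3) (Filter.Eventually.of_forall fun x => ?_)
        · refine mul_nonneg dist_nonneg ?_
          have : ∑ i ∈ Finset.range N, α i * φ i x ≤ ∑ i ∈ Finset.range N, φ i x :=
            Finset.sum_le_sum fun i _ => mul_le_of_le_one_left (hφ0 i x) (hα i)
          have := hφ1 x
          linarith
        · have e : 1 - ∑ i ∈ Finset.range N, α i * φ i x = (1 - ∑ i ∈ Finset.range N, φ i x)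
              + ∑ i ∈ Finset.range N, (1 - α i) * φ i x := by
            simp only [sub_mul, one_mul, Finset.sum_sub_distrib]
            ring
          simp only [e]
          rw [mul_add, Finset.mul_sum]
          refine add_le_add ?_ (Finset.sum_le_sum fun i _ => ?_)
          · have h0 : 0 ≤ ∑ i ∈ Finset.range N, φ i x := Finset.sum_nonneg fun i _ => hφ0 i x
            have h1 := hφ1 x
            set s := ∑ i ∈ Finset.range N, φ i x
            have h2 := le_max_left 0 (dist x₀ x - R)
            have h3 := le_max_right 0 (dist x₀ x - R)
            nlinarith
          · by_cases h : φ i x = 0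
            · simp [h]
            have h1 := hφz i x h
            have h2 := dist_triangle_right x₀ x (z i)
            have h3 : dist x₀ x ≤ dist x₀ (z i) + δ := by linarith
            have := mul_le_mul_of_nonneg_right h3 (mul_nonneg (sub_nonneg.2 (hα i)) (hφ0 i x))
            linarith
    _ = _ := by
        have e0 := integral_add (hk.add i2) i3
        simp only [Pi.add_apply] at e0
        rw [e0, integral_add hk i2,
          integral_finsetSum _ (fun i _ => (hφμ i).const_mul _)]
        simp only [integral_const_mul]
        rw [integral_sub (integrable_const _) (integrable_finsetSum _ fun i _ => hφμ i),
          integral_finsetSum _ (fun i _ => hφμ i)]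
        simp only [← ha, integral_const, probReal_univ, one_smul]
        congr 1
        exact Finset.sum_congr rfl fun i _ => by ring

lemma cut_bound (a b : ℝ) (ha : 0 ≤ a) (hb : 0 ≤ b) :
    a - b * (max a b)⁻¹ * a ≤ |a - b| := by
  rcases le_total a b with h | h
  · rw [max_eq_right h]
    rcases eq_or_lt_of_le hb with h0 | h0
    · have : a = 0 := by linarith
      simp [this]
    · rw [mul_inv_cancel₀ h0.ne']
      simp
  · rw [max_eq_left h]
    rcases eq_or_lt_of_le ha with h0 | h0
    · simp [← h0]
    · rw [mul_assoc, inv_mul_cancel₀ h0.ne', mul_one]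
      exact le_abs_self _

/-- Increasing sequence of bump functions. -/
noncomputable def bumpS {X : Type*} [MetricSpace X] (z : ℕ → X) (δ : ℝ) : ℕ → X → ℝ
  | 0 => fun _ => 0
  | n + 1 => fun x => max (bumpS z δ n x) (max 0 (1 - δ⁻¹ * dist x (z n)))

lemma bumpS_lip {X : Type*} [MetricSpace X] (z : ℕ → X) (δ : ℝ) (n : ℕ) :
    ∃ K : ℝ≥0, LipschitzWith K (bumpS z δ n) := by
  induction n with
  | zero => exact ⟨0, LipschitzWith.const (0 : ℝ)⟩
  | succ n ih =>
    obtain ⟨K, hK⟩ := ih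
    have h1 : LipschitzWith (‖δ⁻¹‖₊ * 1) (fun x => δ⁻¹ * dist x (z n)) :=
      (lipschitzWith_smul (δ⁻¹)).comp (LipschitzWith.dist_left (z n))
    have h2 := (LipschitzWith.const (α := X) (1 : ℝ)).sub h1
    exact ⟨_, hK.max (h2.const_max 0)⟩

lemma bumpS_nonneg {X : Type*} [MetricSpace X] (z : ℕ → X) (δ : ℝ) (n : ℕ) (x : X) :
    0 ≤ bumpS z δ n x := by
  cases n with
  | zero => exact le_rfl
  | succ n => exact le_max_of_le_right (le_max_left _ _)

lemma bumpS_le_one {X : Type*} [MetricSpace X] (z : ℕ → X) (δ : ℝ) (hδ : 0 < δ) (n : ℕ) (x : X) :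
    bumpS z δ n x ≤ 1 := by
  induction n with
  | zero => exact zero_le_one
  | succ n ih =>
    refine max_le ih (max_le zero_le_one ?_)
    have : 0 ≤ δ⁻¹ * dist x (z n) := by positivity
    linarith

lemma bumpS_mono {X : Type*} [MetricSpace X] (z : ℕ → X) (δ : ℝ) (x : X) :
    Monotone (fun n => bumpS z δ n x) :=
  monotone_nat_of_le_succ fun _ => le_max_left _ _

lemma bumpS_supp {X : Type*} [MetricSpace X] (z : ℕ → X) (δ : ℝ) (hδ : 0 < δ) (n : ℕ) (x : X)
    (h : bumpS z δ (n + 1) x - bumpS z δ n x ≠ 0) : dist x (z n) ≤ δ := by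
  by_contra! hd
  apply h
  have h1 : 1 - δ⁻¹ * dist x (z n) ≤ 0 := by
    have : δ⁻¹ * δ ≤ δ⁻¹ * dist x (z n) := by gcongr
    rw [inv_mul_cancel₀ hδ.ne'] at this
    linarith
  change max (bumpS z δ n x) (max 0 (1 - δ⁻¹ * dist x (z n))) - _ = 0
  rw [max_eq_left h1, max_eq_left (bumpS_nonneg z δ n x), sub_self]

lemma bumpS_tendsto {X : Type*} [MetricSpace X] (z : ℕ → X) (hz : DenseRange z) (δ : ℝ)
    (hδ : 0 < δ) (x : X) :
    Filter.Tendsto (fun n => bumpS z δ n x) Filter.atTop (nhds 1) := by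
  rw [Metric.tendsto_atTop]
  intro e he
  obtain ⟨i, hi⟩ := hz.exists_dist_lt x (mul_pos hδ he)
  refine ⟨i + 1, fun n hn => ?_⟩
  have h1 : bumpS z δ (i + 1) x ≤ bumpS z δ n x := bumpS_mono z δ x hn
  have h2 : 1 - δ⁻¹ * dist x (z i) ≤ bumpS z δ (i + 1) x :=
    (le_max_right _ _).trans (le_max_right _ _)
  have h3 : δ⁻¹ * dist x (z i) < e := by
    rw [inv_mul_lt_iff₀ hδ]; exact hi
  have h4 := bumpS_le_one z δ hδ n x
  rw [Real.dist_eq, abs_sub_lt_iff]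
  constructor <;> linarith

lemma core {X : Type*} [MetricSpace X] [TopologicalSpace.SeparableSpace X]
    [MeasurableSpace X] [BorelSpace X] (x₀ : X) (μ₀ : Measure X) (hμ₀ : MemP1 x₀ μ₀)
    (ε : ℝ) (hε : 0 < ε) :
    ∃ (N : ℕ) (g : Option (Fin N) → X → ℝ) (η : ℝ), (∀ i, ∃ K : ℝ≥0, LipschitzWith K (g i)) ∧
      0 < η ∧ ∀ μ, MemP1 x₀ μ → (∀ i, |∫ x, g i x ∂μ - ∫ x, g i x ∂μ₀| < η) → W1 μ μ₀ ≤ ε := by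
  have := UniformSpace.secondCountable_of_separable X
  have : Nonempty X := ⟨x₀⟩
  have := hμ₀.1
  obtain ⟨δ, hδ, hδε⟩ : ∃ δ : ℝ, 0 < δ ∧ 7 * δ ≤ ε := ⟨ε / 7, by positivity, by linarith⟩
  let z := TopologicalSpace.denseSeq X
  have hz : DenseRange z := TopologicalSpace.denseRange_denseSeq X
  have hk : ∀ R : ℝ, ∃ K : ℝ≥0, LipschitzWith K (fun x => max 0 (dist x₀ x - R)) := fun R =>
    ⟨_, (((LipschitzWith.dist_right x₀).sub (LipschitzWith.const R)).const_max 0)⟩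
  have t1 : Filter.Tendsto (fun n : ℕ => ∫ x, max 0 (dist x₀ x - (n : ℝ)) ∂μ₀) Filter.atTop
      (nhds (∫ x, (0 : ℝ) ∂μ₀)) := by
    refine tendsto_integral_of_dominated_convergence (fun x => dist x₀ x) (fun n => ?_) hμ₀.2
      (fun n => Filter.Eventually.of_forall fun x => ?_)
      (Filter.Eventually.of_forall fun x => ?_)
    · exact (hk n).choose_spec.continuous.aestronglyMeasurable
    · rw [Real.norm_eq_abs, abs_of_nonneg (le_max_left _ _)]
      refine max_le dist_nonneg ?_
      have : (0 : ℝ) ≤ n := n.cast_nonneg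
      linarith
    · obtain ⟨M, hM⟩ := exists_nat_ge (dist x₀ x)
      refine tendsto_const_nhds.congr' ?_
      filter_upwards [Filter.eventually_ge_atTop M] with n hn
      have : (M : ℝ) ≤ n := by exact_mod_cast hn
      rw [max_eq_left]
      linarith
  simp only [integral_zero] at t1
  obtain ⟨R, hR⟩ := (t1.eventually (gt_mem_nhds hδ)).exists
  have t2 : Filter.Tendsto (fun n : ℕ => ∫ x, bumpS z δ n x ∂μ₀) Filter.atTop
      (nhds (∫ x, (1 : ℝ) ∂μ₀)) := by
    refine tendsto_integral_of_dominated_convergence (fun x => 1) (fun n => ?_)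
      (integrable_const _)
      (fun n => Filter.Eventually.of_forall fun x => ?_)
      (Filter.Eventually.of_forall fun x => ?_)
    · exact (bumpS_lip z δ n).choose_spec.continuous.aestronglyMeasurable
    · rw [Real.norm_eq_abs, abs_of_nonneg (bumpS_nonneg _ _ _ _)]
      exact bumpS_le_one z δ hδ n x
    · exact bumpS_tendsto z hz δ hδ x
  simp only [integral_const, probReal_univ, one_smul] at t2
  have hR0 : (0 : ℝ) ≤ R := R.cast_nonneg
  obtain ⟨N, hN⟩ := (t2.eventually (lt_mem_nhds
    (show 1 - δ / (R + 1) < 1 by have : 0 < δ / (R + 1) := by positivity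
                                 linarith))).exists
  let φ : ℕ → X → ℝ := fun i x => bumpS z δ (i + 1) x - bumpS z δ i x
  have hφL : ∀ i, ∃ K : ℝ≥0, LipschitzWith K (φ i) := fun i =>
    ⟨_, (bumpS_lip z δ (i + 1)).choose_spec.sub (bumpS_lip z δ i).choose_spec⟩
  have hφs : ∀ x, ∑ i ∈ Finset.range N, φ i x = bumpS z δ N x := fun x => by
    simp only [φ]
    rw [Finset.sum_range_sub (fun n => bumpS z δ n x)]
    simp [bumpS]
  have hφ0 : ∀ i x, 0 ≤ φ i x := fun i x => sub_nonneg.2 (bumpS_mono z δ x (Nat.le_succ i))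
  have hφ1 : ∀ x, ∑ i ∈ Finset.range N, φ i x ≤ 1 := fun x => by
    rw [hφs]; exact bumpS_le_one z δ hδ N x
  have hφz : ∀ i x, φ i x ≠ 0 → dist x (z i) ≤ δ := fun i x h => bumpS_supp z δ hδ i x h
  have hφi : ∀ i μ, MemP1 x₀ μ → Integrable (φ i) μ := fun i μ h =>
    lip_integrable h (hφL i).choose_spec
  set Q : ℝ := ∑ i ∈ Finset.range N, (dist x₀ (z i) + δ) with hQ
  have hQ0 : 0 ≤ Q := Finset.sum_nonneg fun i _ => by positivity
  set C : ℝ := 1 + R * N + 2 * Q with hC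
  have hC0 : 0 < C := by positivity
  refine ⟨N, fun o => o.elim (fun x => max 0 (dist x₀ x - R)) (fun i => φ i), δ / C, ?_,
    by positivity, ?_⟩
  · rintro (_ | i)
    · exact hk R
    · exact hφL i
  intro μ hμ hclose
  have := hμ.1
  set η := δ / C with hη
  have hηC : η * C = δ := div_mul_cancel₀ _ hC0.ne'
  have hcl0 : |∫ x, max 0 (dist x₀ x - (R : ℝ)) ∂μ - ∫ x, max 0 (dist x₀ x - (R : ℝ)) ∂μ₀| < η :=
    hclose none
  have hcl : ∀ i ∈ Finset.range N, |∫ x, φ i x ∂μ - ∫ x, φ i x ∂μ₀| < η := fun i hi =>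
    hclose (some ⟨i, Finset.mem_range.1 hi⟩)
  let a : ℕ → ℝ := fun i => ∫ x, φ i x ∂μ
  let b : ℕ → ℝ := fun i => ∫ x, φ i x ∂μ₀
  let c : ℕ → ℝ := fun i => (max (a i) (b i))⁻¹
  have ha0 : ∀ i, 0 ≤ a i := fun i => integral_nonneg (hφ0 i)
  have hb0 : ∀ i, 0 ≤ b i := fun i => integral_nonneg (hφ0 i)
  have hm0 : ∀ i, 0 ≤ max (a i) (b i) := fun i => le_max_of_le_left (ha0 i)
  have hc0 : ∀ i, 0 ≤ c i := fun i => inv_nonneg.2 (hm0 i)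
  have hbc : ∀ i, b i * c i ≤ 1 := fun i => by
    rw [← div_eq_mul_inv]
    exact div_le_one_of_le₀ (le_max_right _ _) (hm0 i)
  have hac : ∀ i, a i * c i ≤ 1 := fun i => by
    rw [← div_eq_mul_inv]
    exact div_le_one_of_le₀ (le_max_left _ _) (hm0 i)
  have key := W1_le_partial x₀ μ μ₀ hμ hμ₀ N φ z δ hδ.le
    (fun i => (hφL i).choose_spec.continuous.measurable) hφ0 hφ1 hφz (fun i => hφi i μ hμ)
    (fun i => hφi i μ₀ hμ₀) a b c (fun _ => rfl) (fun _ => rfl) (fun _ => rfl)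
  have r1 := resid_bound x₀ μ hμ N φ z δ R hφ0 hφ1 hφz (fun i => hφi i μ hμ)
    (lip_integrable hμ (hk R).choose_spec) a (fun i => b i * c i) (fun _ => rfl)
    (fun i => mul_nonneg (hb0 i) (hc0 i)) hbc
  have r2 := resid_bound x₀ μ₀ hμ₀ N φ z δ R hφ0 hφ1 hφz (fun i => hφi i μ₀ hμ₀)
    (lip_integrable hμ₀ (hk R).choose_spec) b (fun i => a i * c i) (fun _ => rfl)
    (fun i => mul_nonneg (ha0 i) (hc0 i)) hac
  have s1 : ∑ i ∈ Finset.range N, (dist x₀ (z i) + δ) * (a i - b i * c i * a i) ≤ Q * η := by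
    rw [hQ, Finset.sum_mul]
    refine Finset.sum_le_sum fun i hi => mul_le_mul_of_nonneg_left ?_ (by positivity)
    exact (cut_bound (a i) (b i) (ha0 i) (hb0 i)).trans (hcl i hi).le
  have s2 : ∑ i ∈ Finset.range N, (dist x₀ (z i) + δ) * (b i - a i * c i * b i) ≤ Q * η := by
    rw [hQ, Finset.sum_mul]
    refine Finset.sum_le_sum fun i hi => mul_le_mul_of_nonneg_left ?_ (by positivity)
    have h1 := cut_bound (b i) (a i) (hb0 i) (ha0 i)
    rw [max_comm, abs_sub_comm] at h1
    exact h1.trans (hcl i hi).le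
  have sb : ∑ i ∈ Finset.range N, b i = ∫ x, bumpS z δ N x ∂μ₀ := by
    rw [← integral_finsetSum _ (fun i _ => hφi i μ₀ hμ₀)]
    simp only [hφs]
  have sab : ∑ i ∈ Finset.range N, b i - N * η ≤ ∑ i ∈ Finset.range N, a i := by
    have : ∑ i ∈ Finset.range N, (b i - η) ≤ ∑ i ∈ Finset.range N, a i :=
      Finset.sum_le_sum fun i hi => by
        have := (abs_sub_lt_iff.1 (hcl i hi)).2
        simp only [a, b]; linarith
    simpa [Finset.sum_sub_distrib] using this
  have q1 : (R : ℝ) * (1 - ∑ i ∈ Finset.range N, b i) ≤ δ := by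
    have h1 : 1 - ∑ i ∈ Finset.range N, b i ≤ δ / (R + 1) := by rw [sb]; linarith
    calc (R : ℝ) * (1 - ∑ i ∈ Finset.range N, b i) ≤ R * (δ / (R + 1)) := by gcongr
      _ ≤ (R + 1) * (δ / (R + 1)) := by gcongr; linarith
      _ = δ := mul_div_cancel₀ _ (by positivity)
  have q2 : (R : ℝ) * (1 - ∑ i ∈ Finset.range N, a i) ≤ δ + R * N * η := by
    have : (R : ℝ) * (1 - ∑ i ∈ Finset.range N, a i) ≤
      R * (1 - ∑ i ∈ Finset.range N, b i + N * η) := by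
        apply mul_le_mul_of_nonneg_left _ hR0
        linarith
    linarith
  have q3 := (abs_sub_lt_iff.1 hcl0).1
  have q4 : η * C = η + R * N * η + 2 * (Q * η) := by rw [hC]; ring
  linarith

/-- Separation theorem on the Wasserstein space: a convex set `A ⊆ P₁`, closed with respect
to `W₁`, can be separated from a point `μ₀ ∈ P₁ \ A` by a Lipschitz function. -/
theorem stmt_11 {X : Type*} [MetricSpace X] [TopologicalSpace.SeparableSpace X]
    [CompleteSpace X] [MeasurableSpace X] [BorelSpace X] (x₀ : X)
    (A : Set (Measure X)) (hA : ∀ μ ∈ A, MemP1 x₀ μ)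
    (hconv : ∀ μ ∈ A, ∀ ν ∈ A, ∀ t : ℝ, 0 ≤ t → t ≤ 1 →
      (ENNReal.ofReal t) • μ + (ENNReal.ofReal (1 - t)) • ν ∈ A)
    (hclosed : ∀ μ : ℕ → Measure X, (∀ n, μ n ∈ A) → ∀ ν : Measure X, MemP1 x₀ ν →
      Filter.Tendsto (fun n => W1 (μ n) ν) Filter.atTop (nhds 0) → ν ∈ A)
    (μ₀ : Measure X) (hμ₀ : MemP1 x₀ μ₀) (hμ₀A : μ₀ ∉ A) :
    ∃ (f : X → ℝ) (K : ℝ≥0), LipschitzWith K f ∧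
      ∀ μ ∈ A, ∫ x, f x ∂μ₀ < ∫ x, f x ∂μ := by
  have hfar : ∃ ε : ℝ, 0 < ε ∧ ∀ μ ∈ A, ¬ W1 μ μ₀ ≤ ε := by
    by_contra! h
    choose! ν hν hν' using fun n : ℕ => h (1 / ((n : ℝ) + 1)) (by positivity)
    refine hμ₀A (hclosed ν hν μ₀ hμ₀ ?_)
    exact squeeze_zero (fun n => W1_nonneg _ _) hν' tendsto_one_div_add_atTop_nhds_zero_nat
  obtain ⟨ε, hε, hfar⟩ := hfar
  obtain ⟨N, g, η, hg, hη, h⟩ := core x₀ μ₀ hμ₀ ε hε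
  exact separate x₀ A hA hconv μ₀ hμ₀ g hg η hη
    (fun μ hμ hc => hfar μ hμ (h μ (hA μ hμ) hc))
end

section
/- Let φ : P₁ → ℝ ∪ {+∞} be proper, convex and lower semicontinuous on the Wasserstein space, with conjugate ρ(f) = sup_μ (∫ f dμ − φ(μ)). Let N̄ = {f Lipschitz : ρ(f) ≤ 0} = {f Lipschitz : ∫ f dμ ≤ φ(μ) for all μ}. Then φ(μ) = sup_{f ∈ N̄} ∫ f dμ for every μ ∈ P₁. -/
open MeasureTheory
open scoped NNReal

set_option linter.unusedSectionVars false
set_option linter.style.haveILetI false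

lemma cone_comb {V : Type*} [AddCommGroup V] [Module ℝ V] {A : Set V} (hA : Convex ℝ A)
    {a a' : V} (ha : a ∈ A) (ha' : a' ∈ A) {s s' : ℝ} (hs : 0 ≤ s) (hs' : 0 ≤ s') :
    ∃ c ∈ A, s • a + s' • a' = (s + s') • c := by
  rcases (add_nonneg hs hs').eq_or_lt with h | h
  · have h1 : s = 0 := by linarith
    have h2 : s' = 0 := by linarith
    exact ⟨a, ha, by simp [h1, h2]⟩
  · refine ⟨_, convex_iff_div.1 hA ha ha' hs hs' h, ?_⟩
    simp only [smul_add, smul_smul, mul_div_assoc', mul_div_cancel_left₀ _ h.ne']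

lemma hb_sep {V : Type*} [AddCommGroup V] [Module ℝ V] (A B : Set (V × ℝ))
    (hA : Convex ℝ A) (hB : Convex ℝ B)
    (hsep : ∀ a ∈ A, ∀ b ∈ B, ∀ s t : ℝ, 0 ≤ s → 0 ≤ t → s • a.1 + t • b.1 = 0 →
      0 ≤ s * a.2 + t * b.2)
    (hcof : ∀ v : V, ∃ a ∈ A, ∃ b ∈ B, ∃ s t : ℝ, 0 ≤ s ∧ 0 ≤ t ∧ s • a.1 + t • b.1 = v) :
    ∃ l : V →ₗ[ℝ] ℝ, (∀ a ∈ A, l a.1 ≤ a.2) ∧ ∀ b ∈ B, l b.1 ≤ b.2 := by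
  obtain ⟨a0, ha0, b0, hb0, -⟩ := hcof 0
  let C : PointedCone ℝ (V × ℝ) :=
    { carrier := {v | ∃ a ∈ A, ∃ b ∈ B, ∃ s t : ℝ, 0 ≤ s ∧ 0 ≤ t ∧ s • a + t • b = v}
      add_mem' := by
        rintro _ _ ⟨a, ha, b, hb, s, t, hs, ht, rfl⟩ ⟨a', ha', b', hb', s', t', hs', ht', rfl⟩
        obtain ⟨c, hc, e⟩ := cone_comb hA ha ha' hs hs'
        obtain ⟨d, hd, e'⟩ := cone_comb hB hb hb' ht ht'
        refine ⟨c, hc, d, hd, s + s', t + t', by positivity, by positivity, ?_⟩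
        rw [← e, ← e']; abel
      zero_mem' := ⟨a0, ha0, b0, hb0, 0, 0, le_rfl, le_rfl, by simp⟩
      smul_mem' := by
        rintro c _ ⟨a, ha, b, hb, s, t, hs, ht, rfl⟩
        refine ⟨a, ha, b, hb, c * s, c * t, mul_nonneg c.2 hs, mul_nonneg c.2 ht, ?_⟩
        rw [smul_add, mul_smul, mul_smul]; rfl }
  have hC : ∀ v, v ∈ C ↔ ∃ a ∈ A, ∃ b ∈ B, ∃ s t : ℝ, 0 ≤ s ∧ 0 ≤ t ∧ s • a + t • b = v :=
    fun v => Iff.rfl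
  let f : (V × ℝ) →ₗ.[ℝ] ℝ :=
    { domain := LinearMap.range (LinearMap.inr ℝ V ℝ)
      toFun := (LinearMap.snd ℝ V ℝ).comp (Submodule.subtype _) }
  have hf : ∀ x : f.domain, f x = (x : V × ℝ).2 := fun x => rfl
  obtain ⟨g, hg, hgC⟩ := riesz_extension C f (by
      rintro ⟨_, ⟨r, rfl⟩⟩ hx
      obtain ⟨a, ha, b, hb, s, t, hs, ht, e⟩ := (hC _).1 hx
      rw [hf]
      have h1 := congrArg Prod.fst e
      have h2 := congrArg Prod.snd e
      simp at h1 h2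
      simp only [LinearMap.inr_apply]
      rw [← h2]
      exact hsep a ha b hb s t hs ht h1)
    (by
      rintro ⟨v, c⟩
      obtain ⟨a, ha, b, hb, s, t, hs, ht, e⟩ := hcof v
      refine ⟨⟨(0, s * a.2 + t * b.2 - c), ⟨_, rfl⟩⟩, (hC _).2 ⟨a, ha, b, hb, s, t, hs, ht, ?_⟩⟩
      ext
      · simp [← e]
      · simp)
  have hg2 : ∀ r : ℝ, g (0, r) = r := fun r => by
    have := hg ⟨(0, r), ⟨r, rfl⟩⟩
    rw [hf] at this
    exact this
  have hg3 : ∀ v : V, ∀ r : ℝ, g (v, r) = g (v, 0) + r := fun v r => by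
    rw [← hg2 r, ← map_add, hg2]; simp
  refine ⟨-(g.comp (LinearMap.inl ℝ V ℝ)), ?_, ?_⟩
  · rintro ⟨v, r⟩ ha
    have := hgC (v, r) ((hC _).2 ⟨_, ha, b0, hb0, 1, 0, zero_le_one, le_rfl, by simp⟩)
    rw [hg3] at this
    simp
    linarith
  · rintro ⟨v, r⟩ hb
    have := hgC (v, r) ((hC _).2 ⟨a0, ha0, _, hb, 0, 1, le_rfl, zero_le_one, by simp⟩)
    rw [hg3] at this
    simp
    linarith

def Cpl {X : Type*} [MeasurableSpace X] (π : Measure (X × X)) (μ ν : Measure X) : Prop :=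
  IsProbabilityMeasure π ∧ π.map Prod.fst = μ ∧ π.map Prod.snd = ν

lemma Cpl.prod {X : Type*} [MeasurableSpace X] (μ ν : Measure X) [IsProbabilityMeasure μ]
    [IsProbabilityMeasure ν] : Cpl (μ.prod ν) μ ν :=
  ⟨inferInstance, by simp, by simp⟩

lemma mix_prob {X : Type*} [MeasurableSpace X] (μ ν : Measure X) [IsProbabilityMeasure μ]
    [IsProbabilityMeasure ν] {t : ℝ} (h0 : 0 ≤ t) (h1 : t ≤ 1) :
    IsProbabilityMeasure ((ENNReal.ofReal t) • μ + (ENNReal.ofReal (1 - t)) • ν) := by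
  constructor
  simp [← ENNReal.ofReal_add h0 (sub_nonneg.2 h1)]

lemma mix_integral {X : Type*} [MeasurableSpace X] (μ ν : Measure X) {f : X → ℝ}
    (hμ : Integrable f μ) (hν : Integrable f ν) {t : ℝ} (h0 : 0 ≤ t) (h1 : t ≤ 1) :
    Integrable f ((ENNReal.ofReal t) • μ + (ENNReal.ofReal (1 - t)) • ν) ∧
    ∫ x, f x ∂((ENNReal.ofReal t) • μ + (ENNReal.ofReal (1 - t)) • ν) =
      t * ∫ x, f x ∂μ + (1 - t) * ∫ x, f x ∂ν := by
  have i1 := hμ.smul_measure (c := ENNReal.ofReal t) ENNReal.ofReal_ne_top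
  have i2 := hν.smul_measure (c := ENNReal.ofReal (1 - t)) ENNReal.ofReal_ne_top
  refine ⟨i1.add_measure i2, ?_⟩
  rw [integral_add_measure i1 i2, integral_smul_measure, integral_smul_measure,
    ENNReal.toReal_ofReal h0, ENNReal.toReal_ofReal (sub_nonneg.2 h1)]
  rfl

lemma Cpl.mix {X : Type*} [MeasurableSpace X] {π π' : Measure (X × X)} {μ ν μ' ν' : Measure X}
    (h : Cpl π μ ν) (h' : Cpl π' μ' ν') {t : ℝ} (h0 : 0 ≤ t) (h1 : t ≤ 1) :
    Cpl ((ENNReal.ofReal t) • π + (ENNReal.ofReal (1 - t)) • π')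
      ((ENNReal.ofReal t) • μ + (ENNReal.ofReal (1 - t)) • μ')
      ((ENNReal.ofReal t) • ν + (ENNReal.ofReal (1 - t)) • ν') := by
  obtain ⟨a, rfl, rfl⟩ := h
  obtain ⟨b, rfl, rfl⟩ := h'
  refine ⟨mix_prob _ _ h0 h1, ?_, ?_⟩
  · rw [Measure.map_add _ _ measurable_fst, Measure.map_smul, Measure.map_smul]
  · rw [Measure.map_add _ _ measurable_snd, Measure.map_smul, Measure.map_smul]

section
variable {X : Type*} [MetricSpace X] [SecondCountableTopology X]
    [CompleteSpace X] [MeasurableSpace X] [BorelSpace X]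

lemma MemP1.mix {x₀ : X} {μ ν : Measure X} (hμ : MemP1 x₀ μ) (hν : MemP1 x₀ ν)
    {t : ℝ} (h0 : 0 ≤ t) (h1 : t ≤ 1) :
    MemP1 x₀ ((ENNReal.ofReal t) • μ + (ENNReal.ofReal (1 - t)) • ν) := by
  haveI := hμ.1
  haveI := hν.1
  exact ⟨mix_prob _ _ h0 h1, (mix_integral _ _ hμ.2 hν.2 h0 h1).1⟩

lemma MemP1.lip {x₀ : X} {μ : Measure X} (hμ : MemP1 x₀ μ) {K : ℝ≥0} {f : X → ℝ}
    (hf : LipschitzWith K f) : Integrable f μ := by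
  haveI := hμ.1
  refine Integrable.mono' ((integrable_const |f x₀|).add (hμ.2.const_mul K))
    hf.continuous.aestronglyMeasurable (Filter.Eventually.of_forall fun x => ?_)
  have := hf.dist_le_mul x x₀
  rw [Real.dist_eq, dist_comm] at this
  simp only [Pi.add_apply, Real.norm_eq_abs]
  have h2 := abs_sub_abs_le_abs_sub (f x) (f x₀)
  linarith

lemma Cpl.integrable {x₀ : X} {μ ν : Measure X} {π : Measure (X × X)} (h : Cpl π μ ν)
    (hμ : MemP1 x₀ μ) (hν : MemP1 x₀ ν) : Integrable (fun p : X × X => dist p.1 p.2) π := by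
  obtain ⟨a, rfl, rfl⟩ := h
  have i1 := hμ.2.comp_measurable measurable_fst
  have i2 := hν.2.comp_measurable measurable_snd
  refine Integrable.mono' (i1.add i2) continuous_dist.aestronglyMeasurable
    (Filter.Eventually.of_forall fun p => ?_)
  simp only [Pi.add_apply, Function.comp_apply, Real.norm_eq_abs, abs_of_nonneg dist_nonneg]
  exact dist_triangle_left _ _ _

open ProbabilityTheory in
lemma Cpl.glue {x₀ : X} {μ ν ρ : Measure X} {π₁ π₂ : Measure (X × X)} (h1 : Cpl π₁ μ ν)
    (h2 : Cpl π₂ ν ρ) (hμ : MemP1 x₀ μ) (hν : MemP1 x₀ ν) (hρ : MemP1 x₀ ρ) :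
    ∃ π, Cpl π μ ρ ∧ ∫ p, dist p.1 p.2 ∂π ≤ ∫ p, dist p.1 p.2 ∂π₁ + ∫ p, dist p.1 p.2 ∂π₂ := by
  haveI : Nonempty X := ⟨x₀⟩
  have j1 := h1.integrable hμ hν
  have j2 := h2.integrable hν hρ
  obtain ⟨a, e1, e2⟩ := h1
  obtain ⟨b, e3, e4⟩ := h2
  let κ := π₂.condKernel
  let γ : Measure ((X × X) × X) := π₁ ⊗ₘ (κ.comap Prod.snd measurable_snd)
  have g1 : γ.map Prod.fst = π₁ := Measure.fst_compProd _ _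
  have hm : Measurable (fun q : (X × X) × X => (q.1.2, q.2)) := by fun_prop
  have g2 : γ.map (fun q => (q.1.2, q.2)) = π₂ := by
    rw [← π₂.disintegrate π₂.condKernel]
    ext s hs
    rw [Measure.map_apply hm hs, Measure.compProd_apply (hm hs), Measure.compProd_apply hs]
    have : π₂.fst = π₁.map Prod.snd := by rw [e2, ← e3]; rfl
    rw [this, lintegral_map (Kernel.measurable_kernel_prodMk_left hs) measurable_snd]
    rfl
  have hm2 : Measurable (fun q : (X × X) × X => (q.1.1, q.2)) := by fun_prop
  haveI : IsProbabilityMeasure γ := by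
    constructor
    have : γ.map Prod.fst Set.univ = 1 := by rw [g1]; simp
    rwa [Measure.map_apply measurable_fst MeasurableSet.univ] at this
  refine ⟨γ.map (fun q => (q.1.1, q.2)), ⟨Measure.isProbabilityMeasure_map hm2.aemeasurable,
    ?_, ?_⟩, ?_⟩
  · rw [Measure.map_map measurable_fst hm2, ← e1, ← g1, Measure.map_map measurable_fst measurable_fst]
    rfl
  · rw [Measure.map_map measurable_snd hm2, ← e4, ← g2, Measure.map_map measurable_snd hm]
    rfl
  · have k1 := j1
    have k2 := j2
    rw [← g1] at k1
    rw [← g2] at k2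
    have k1 := k1.comp_measurable measurable_fst
    have k2 := k2.comp_measurable hm
    have d : ∀ m : Measure (X × X), AEStronglyMeasurable (fun p : X × X => dist p.1 p.2) m :=
      fun m => continuous_dist.aestronglyMeasurable
    rw [integral_map hm2.aemeasurable (d _)]
    conv_rhs => rw [← g1, ← g2, integral_map hm.aemeasurable (d _),
      integral_map measurable_fst.aemeasurable (d _)]
    refine le_trans ?_ (integral_add k1 k2).le
    exact integral_mono_of_nonneg (Filter.Eventually.of_forall fun _ => dist_nonneg) (k1.add k2)
      (Filter.Eventually.of_forall fun q => dist_triangle _ _ _)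

lemma approx_id {x₀ : X} {ν : Measure X} (hν : MemP1 x₀ ν) {δ : ℝ} (hδ : 0 < δ) :
    ∃ T : SimpleFunc X X, ∫ x, dist x (T x) ∂ν < δ := by
  have ht := tendsto_integral_of_dominated_convergence (μ := ν)
    (F := fun n x => dist x (SimpleFunc.approxOn id measurable_id Set.univ x₀ (Set.mem_univ _) n x))
    (f := fun _ => (0 : ℝ))
    (fun x => dist x₀ x)
    (fun n => (Measurable.dist measurable_id (SimpleFunc.measurable _)).aestronglyMeasurable)
    hν.2
    (fun n => Filter.Eventually.of_forall fun x => by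
      have := SimpleFunc.edist_approxOn_le (measurable_id (α := X)) (Set.mem_univ x₀) x n
      rw [edist_dist, edist_dist, ENNReal.ofReal_le_ofReal_iff dist_nonneg] at this
      rw [Real.norm_eq_abs, abs_of_nonneg dist_nonneg, dist_comm]
      exact this)
    (Filter.Eventually.of_forall fun x => by
      have := SimpleFunc.tendsto_approxOn (measurable_id (α := X)) (Set.mem_univ x₀)
        (x := x) (by simp)
      have h2 := (tendsto_const_nhds (x := x)).dist this
      simpa using h2)
  simp only [integral_zero] at ht
  obtain ⟨n, hn⟩ := (ht.eventually_lt_const hδ).exists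
  exact ⟨_, hn⟩

lemma integrable_simple {x₀ : X} {ν : Measure X} (hν : MemP1 x₀ ν) (T : SimpleFunc X X)
    (f : X → ℝ) : Integrable (fun x => f (T x)) ν := by
  haveI := hν.1
  exact SimpleFunc.integrable_of_isFiniteMeasure (T.map f)

lemma integrable_dist_simple {x₀ : X} {ν : Measure X} (hν : MemP1 x₀ ν) (T : SimpleFunc X X) :
    Integrable (fun x => dist x (T x)) ν := by
  refine Integrable.mono' (hν.2.add (integrable_simple hν T (fun y => dist x₀ y)))
    (Measurable.dist measurable_id (SimpleFunc.measurable _)).aestronglyMeasurable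
    (Filter.Eventually.of_forall fun p => ?_)
  simp only [Pi.add_apply, Real.norm_eq_abs, abs_of_nonneg dist_nonneg]
  exact dist_triangle_left _ _ _

lemma Cpl.map {Y : Type*} [MeasurableSpace Y] (ν : Measure Y) [IsProbabilityMeasure ν] {S T : Y → X}
    (hS : Measurable S) (hT : Measurable T) :
    Cpl (ν.map (fun y => (S y, T y))) (ν.map S) (ν.map T) ∧
    ∫ p, dist p.1 p.2 ∂(ν.map (fun y => (S y, T y))) = ∫ y, dist (S y) (T y) ∂ν := by
  have hm : Measurable (fun y => (S y, T y)) := hS.prodMk hT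
  refine ⟨⟨Measure.isProbabilityMeasure_map hm.aemeasurable, ?_, ?_⟩, ?_⟩
  · rw [Measure.map_map measurable_fst hm]; rfl
  · rw [Measure.map_map measurable_snd hm]; rfl
  · rw [integral_map hm.aemeasurable continuous_dist.aestronglyMeasurable]

lemma cost_nonneg (π : Measure (X × X)) : 0 ≤ ∫ p, dist p.1 p.2 ∂π :=
  integral_nonneg fun _ => dist_nonneg

lemma low_bound {x₀ : X} (E : Measure X → ℝ → Prop) (hmem : ∀ l y, E l y → MemP1 x₀ l)
    (hconv : ∀ l y l' y' (t : ℝ), E l y → E l' y' → 0 ≤ t → t ≤ 1 →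
      E ((ENNReal.ofReal t) • l + (ENNReal.ofReal (1 - t)) • l') (t * y + (1 - t) * y'))
    (hne : ∃ l y, E l y) (hb : ∀ l, MemP1 x₀ l → ∃ b, ¬ E l b)
    (hl : ∀ ν, MemP1 x₀ ν → ∀ a, ¬ E ν a → ∃ ε > 0, ∀ l y π, E l y → Cpl π l ν →
      ∫ p, dist p.1 p.2 ∂π < ε → a < y)
    {μ₀ : Measure X} (hμ₀ : MemP1 x₀ μ₀) {a : ℝ} (ha : ¬ E μ₀ a) :
    ∃ L : ℝ, 0 ≤ L ∧ ∀ l y π, E l y → Cpl π l μ₀ → a ≤ y + L * ∫ p, dist p.1 p.2 ∂π := by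
  obtain ⟨l₀, y₀, h₀⟩ := hne
  have m₀ := hmem _ _ h₀
  have := m₀.1
  have := hμ₀.1
  obtain ⟨b, hb⟩ := hb l₀ m₀
  obtain ⟨ε, hε, h1⟩ := hl l₀ m₀ b hb
  obtain ⟨dg, dc⟩ := Cpl.map l₀ (measurable_id (α := X)) (measurable_id (α := X))
  simp only [Measure.map_id] at dg
  simp only [id, dist_self, integral_zero] at dc dg
  have hby : b < y₀ := h1 l₀ y₀ _ h₀ dg (by rw [dc]; exact hε)
  have s1 : ∀ l y π, E l y → Cpl π l l₀ →
      b - (2 * (y₀ - b) / ε) * ∫ p, dist p.1 p.2 ∂π ≤ y := by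
    intro l y π hE hπ
    have hL : 0 ≤ 2 * (y₀ - b) / ε := by
      have := sub_pos.2 hby
      positivity
    set D := ∫ p, dist p.1 p.2 ∂π with hD
    have hD0 : 0 ≤ D := cost_nonneg π
    by_cases hDε : D < ε
    · have := h1 l y π hE hπ hDε
      have := mul_nonneg hL hD0
      linarith
    · have hDε : ε ≤ D := not_lt.1 hDε
      have hDp : 0 < D := hε.trans_le hDε
      set t := ε / (2 * D) with ht
      have t0 : 0 < t := by positivity
      have t1 : t ≤ 1 := by rw [ht, div_le_one (by positivity)]; linarith
      have hc := hπ.mix dg t0.le t1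
      have mi := (mix_integral _ _ (hπ.integrable (hmem _ _ hE) m₀) (dg.integrable m₀ m₀)
        t0.le t1).2
      rw [dc, ← hD] at mi
      have e1 : ENNReal.ofReal t • l₀ + ENNReal.ofReal (1 - t) • l₀ = l₀ := by
        rw [← add_smul, ← ENNReal.ofReal_add t0.le (sub_nonneg.2 t1)]; simp
      rw [e1] at hc
      have tD : t * D = ε / 2 := by rw [ht]; field_simp
      have := h1 _ _ _ (hconv _ _ _ _ t hE h₀ t0.le t1) hc (by rw [mi, tD]; linarith)
      have e2 : 2 * (y₀ - b) / ε * D = (y₀ - b) / t := by rw [ht]; field_simp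
      rw [e2]
      have : y₀ - (y₀ - b) / t ≤ y := by
        rw [sub_le_comm, le_div_iff₀ t0]
        nlinarith
      linarith
  set L₀ := 2 * (y₀ - b) / ε with hL₀
  have hL : 0 ≤ L₀ := by
    have := sub_pos.2 hby
    positivity
  have c0 := Cpl.prod μ₀ l₀
  set c₀ := ∫ p, dist p.1 p.2 ∂(μ₀.prod l₀)
  obtain ⟨ε', hε', h2⟩ := hl μ₀ hμ₀ a ha
  set c := b - L₀ * c₀ with hc
  refine ⟨L₀ + |a - c| / ε', by positivity, ?_⟩
  intro l y π hE hπ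
  set D := ∫ p, dist p.1 p.2 ∂π with hD
  have hD0 : 0 ≤ D := cost_nonneg π
  by_cases hDε : D < ε'
  · have := h2 l y π hE hπ hDε
    have : 0 ≤ (L₀ + |a - c| / ε') * D := by positivity
    linarith
  · have hDε : ε' ≤ D := not_lt.1 hDε
    obtain ⟨π', h', hle⟩ := hπ.glue c0 (hmem _ _ hE) hμ₀ m₀
    have h3 := s1 l y π' hE h'
    have h4 := mul_le_mul_of_nonneg_left hle hL
    have h5 : |a - c| ≤ |a - c| / ε' * D := by
      rw [div_mul_eq_mul_div, le_div_iff₀ hε']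
      exact mul_le_mul_of_nonneg_left hDε (abs_nonneg _)
    have h6 := le_abs_self (a - c)
    rw [add_mul]
    rw [mul_add] at h4
    linarith

noncomputable def FM (X : Type*) [MeasurableSpace X] : (X →₀ ℝ≥0) →ₗ[ℝ≥0] Measure X :=
  Finsupp.linearCombination ℝ≥0 Measure.dirac

noncomputable def FR (X : Type*) : (X →₀ ℝ≥0) →+ (X →₀ ℝ) :=
  Finsupp.mapRange.addMonoidHom NNReal.toRealHom.toAddMonoidHom

lemma FR_apply (α : X →₀ ℝ≥0) (x : X) : FR X α x = α x := rfl

lemma FR_smul (c : ℝ≥0) (α : X →₀ ℝ≥0) : FR X (c • α) = (c : ℝ) • FR X α := by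
  ext x; simp [FR_apply]

lemma FR_single (x : X) (c : ℝ≥0) : FR X (Finsupp.single x c) = Finsupp.single x (c : ℝ) := by
  simp [FR]

lemma FM_single (x : X) (c : ℝ≥0) : FM X (Finsupp.single x c) = c • Measure.dirac x := by
  simp [FM]

lemma FM_integral (f : X → ℝ) (α : X →₀ ℝ≥0) : Integrable f (FM X α) ∧
    ∀ l : (X →₀ ℝ) →ₗ[ℝ] ℝ, (∀ x, l (Finsupp.single x 1) = f x) →
      ∫ x, f x ∂(FM X α) = l (FR X α) := by
  induction α using Finsupp.induction_linear with
  | zero => simp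
  | add α β h1 h2 =>
    rw [map_add, map_add]
    refine ⟨h1.1.add_measure h2.1, fun l hl => ?_⟩
    rw [integral_add_measure h1.1 h2.1, map_add, h1.2 l hl, h2.2 l hl]
  | single x c =>
    rw [FM_single, FR_single]
    have hi : Integrable f (Measure.dirac x) := integrable_dirac (by simp)
    refine ⟨hi.smul_measure_nnreal, fun l hl => ?_⟩
    rw [integral_smul_nnreal_measure, integral_dirac, ← hl x]
    have : Finsupp.single x (c : ℝ) = (c : ℝ) • Finsupp.single x (1 : ℝ) := by simp
    rw [this, map_smul]; rfl

lemma FM_mem (x₀ : X) (α : X →₀ ℝ≥0) (h : IsProbabilityMeasure (FM X α)) : MemP1 x₀ (FM X α) :=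
  ⟨h, (FM_integral _ _).1⟩

lemma FM_mix (α β : X →₀ ℝ≥0) {t : ℝ} (h0 : 0 ≤ t) (h1 : t ≤ 1) :
    ∃ γ, FM X γ = ENNReal.ofReal t • FM X α + ENNReal.ofReal (1 - t) • FM X β ∧
      FR X γ = t • FR X α + (1 - t) • FR X β := by
  refine ⟨t.toNNReal • α + (1 - t).toNNReal • β, ?_, ?_⟩
  · rw [map_add, map_smul, map_smul]; rfl
  · rw [map_add, FR_smul, FR_smul, Real.coe_toNNReal _ h0, Real.coe_toNNReal _ (sub_nonneg.2 h1)]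

lemma FM_simple (ν : Measure X) [IsProbabilityMeasure ν] (T : SimpleFunc X X) :
    ∃ α, FM X α = ν.map T := by
  refine ⟨∑ y ∈ T.range, Finsupp.single y (ν (T ⁻¹' {y})).toNNReal, ?_⟩
  rw [map_sum]
  simp_rw [FM_single]
  ext s hs
  rw [Measure.map_apply T.measurable hs, Measure.finsetSum_apply]
  have : ∀ y, ((ν (T ⁻¹' {y})).toNNReal • Measure.dirac y) s = ν (T ⁻¹' {y}) * s.indicator 1 y := by
    intro y
    rw [Measure.smul_apply, Measure.dirac_apply' _ hs, ENNReal.smul_def, smul_eq_mul,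
      ENNReal.coe_toNNReal (measure_ne_top _ _)]
  simp_rw [this]
  classical
  have e : T ⁻¹' s = ⋃ y ∈ T.range.filter (fun y => y ∈ s), T ⁻¹' {y} := by
    ext x; simp
  rw [e, measure_biUnion_finset, Finset.sum_filter]
  · refine Finset.sum_congr rfl fun y _ => ?_
    by_cases hy : y ∈ s <;> simp [hy]
  · intro y _ z _ hyz
    exact Disjoint.preimage _ (by simpa using hyz)
  · intro y _
    exact T.measurableSet_fiber y

lemma FM_mass (α : X →₀ ℝ≥0) (h : IsProbabilityMeasure (FM X α)) :
    Finsupp.linearCombination ℝ (fun _ : X => (1 : ℝ)) (FR X α) = 1 := by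
  rw [← (FM_integral (fun _ => (1 : ℝ)) α).2 _ (by simp)]
  simp

lemma FM_univ (α : X →₀ ℝ≥0) : FM X α Set.univ = (α.sum fun _ c => c : ℝ≥0) := by
  induction α using Finsupp.induction_linear with
  | zero => simp
  | add α β h1 h2 =>
    rw [map_add, Measure.add_apply, h1, h2, Finsupp.sum_add_index' (by simp) (by simp)]
    simp
  | single x c =>
    rw [FM_single]
    rw [Measure.smul_apply, measure_univ, Finsupp.sum_single_index rfl, ENNReal.smul_def,
      smul_eq_mul, mul_one]

lemma FM_normalize (x₀ : X) (α : X →₀ ℝ≥0) : ∃ s : ℝ, 0 ≤ s ∧ ∃ β, IsProbabilityMeasure (FM X β) ∧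
    FR X α = s • FR X β := by
  by_cases h : (α.sum fun _ c => c) = 0
  · have : α = 0 := by
      ext x
      by_contra hx
      rw [Finsupp.sum, Finset.sum_eq_zero_iff] at h
      have := h x (by simpa using fun e => hx (by simp [e]))
      exact hx (by simp [this])
    refine ⟨0, le_rfl, Finsupp.single x₀ 1, ?_, by simp [this]⟩
    rw [FM_single, one_smul]; infer_instance
  · refine ⟨(α.sum fun _ c => c : ℝ≥0), NNReal.coe_nonneg _, (α.sum fun _ c => c)⁻¹ • α, ⟨?_⟩, ?_⟩
    · rw [map_smul, Measure.smul_apply, FM_univ, ENNReal.smul_def, smul_eq_mul, ← ENNReal.coe_mul,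
        inv_mul_cancel₀ h, ENNReal.coe_one]
    · rw [← FR_smul, smul_smul, mul_inv_cancel₀ h, one_smul]

lemma FR_split (v : X →₀ ℝ) : ∃ α β, v = FR X α - FR X β := by
  refine ⟨v.mapRange Real.toNNReal (by simp), (-v).mapRange Real.toNNReal (by simp), ?_⟩
  ext x
  simp only [Finsupp.sub_apply, FR_apply, Finsupp.mapRange_apply, Finsupp.neg_apply,
    Real.coe_toNNReal']
  rcases le_total 0 (v x) with h | h
  · rw [max_eq_left h, max_eq_right (by linarith)]; ring
  · rw [max_eq_right h, max_eq_left (by linarith)]; ring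

lemma main_functional {x₀ : X} (E : Measure X → ℝ → Prop) (hmem : ∀ l y, E l y → MemP1 x₀ l)
    (hconv : ∀ l y l' y' (t : ℝ), E l y → E l' y' → 0 ≤ t → t ≤ 1 →
      E ((ENNReal.ofReal t) • l + (ENNReal.ofReal (1 - t)) • l') (t * y + (1 - t) * y'))
    (hne : ∃ l y, E l y)
    {μ₀ : Measure X} (hμ₀ : MemP1 x₀ μ₀) {a L : ℝ} (hL : 0 ≤ L)
    (hlow : ∀ l y π, E l y → Cpl π l μ₀ → a ≤ y + L * ∫ p, dist p.1 p.2 ∂π) :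
    ∃ f : X → ℝ,
      (∀ α l y π, IsProbabilityMeasure (FM X α) → E l y → Cpl π l (FM X α) →
        ∫ x, f x ∂(FM X α) ≤ y + L * ∫ p, dist p.1 p.2 ∂π) ∧
      (∀ β π, IsProbabilityMeasure (FM X β) → Cpl π (FM X β) μ₀ →
        a ≤ ∫ x, f x ∂(FM X β) + L * ∫ p, dist p.1 p.2 ∂π) := by
  have := hμ₀.1
  let A : Set ((X →₀ ℝ) × ℝ) := {p | ∃ α l y π, IsProbabilityMeasure (FM X α) ∧ E l y ∧
    Cpl π l (FM X α) ∧ p = (FR X α, y + L * ∫ p, dist p.1 p.2 ∂π)}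
  let B : Set ((X →₀ ℝ) × ℝ) := {p | ∃ β π, IsProbabilityMeasure (FM X β) ∧
    Cpl π (FM X β) μ₀ ∧ p = (-FR X β, L * ∫ p, dist p.1 p.2 ∂π - a)}
  have cvx : ∀ S : Set ((X →₀ ℝ) × ℝ), (∀ p ∈ S, ∀ q ∈ S, ∀ t : ℝ, 0 ≤ t → t ≤ 1 →
      t • p + (1 - t) • q ∈ S) → Convex ℝ S := by
    intro S h p hp q hq s t hs ht hst
    obtain rfl : t = 1 - s := by linarith
    exact h p hp q hq s hs (by linarith)
  have hA : Convex ℝ A := by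
    refine cvx A ?_
    rintro _ ⟨α, l, y, π, hα, hE, hπ, rfl⟩ _ ⟨α', l', y', π', hα', hE', hπ', rfl⟩ t h0 h1
    obtain ⟨γ, g1, g2⟩ := FM_mix α α' h0 h1
    refine ⟨γ, _, _, ENNReal.ofReal t • π + ENNReal.ofReal (1 - t) • π', ?_, hconv _ _ _ _ t hE hE' h0 h1, ?_, ?_⟩
    · rw [g1]; exact mix_prob _ _ h0 h1
    · rw [g1]; exact hπ.mix hπ' h0 h1
    · rw [(mix_integral _ _ (hπ.integrable (hmem _ _ hE) (FM_mem x₀ α hα))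
        (hπ'.integrable (hmem _ _ hE') (FM_mem x₀ α' hα')) h0 h1).2, g2]
      ext1
      · rfl
      · simp; ring
  have hB : Convex ℝ B := by
    refine cvx B ?_
    rintro _ ⟨α, π, hα, hπ, rfl⟩ _ ⟨α', π', hα', hπ', rfl⟩ t h0 h1
    obtain ⟨γ, g1, g2⟩ := FM_mix α α' h0 h1
    have e1 : ENNReal.ofReal t • μ₀ + ENNReal.ofReal (1 - t) • μ₀ = μ₀ := by
      rw [← add_smul, ← ENNReal.ofReal_add h0 (sub_nonneg.2 h1)]; simp
    refine ⟨γ, ENNReal.ofReal t • π + ENNReal.ofReal (1 - t) • π', ?_, ?_, ?_⟩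
    · rw [g1]; exact mix_prob _ _ h0 h1
    · have := hπ.mix hπ' h0 h1
      rwa [e1, ← g1] at this
    · rw [(mix_integral _ _ (hπ.integrable (FM_mem x₀ α hα) hμ₀)
        (hπ'.integrable (FM_mem x₀ α' hα') hμ₀) h0 h1).2, g2]
      ext1
      · simp [add_comm]
      · simp; ring
  obtain ⟨l, hlA, hlB⟩ := hb_sep A B hA hB
    (by
      rintro _ ⟨α, l, y, π, hα, hE, hπ, rfl⟩ _ ⟨β, π', hβ, hπ', rfl⟩ s t hs ht e
      simp only at e ⊢
      have e1 := congrArg (Finsupp.linearCombination ℝ (fun _ : X => (1 : ℝ))) e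
      rw [map_add, map_smul, map_smul, map_neg, FM_mass α hα, FM_mass β hβ, map_zero] at e1
      simp only [smul_eq_mul] at e1
      obtain rfl : s = t := by linarith
      rcases hs.eq_or_lt with h | h
      · rw [← h]; simp
      · have e2 : FR X α = FR X β := by
          rw [← smul_add] at e
          have := (smul_eq_zero.1 e).resolve_left h.ne'
          rwa [← sub_eq_add_neg, sub_eq_zero] at this
        have e3 : α = β := by
          ext x
          have := DFunLike.congr_fun e2 x
          rwa [FR_apply, FR_apply] at this
        subst e3
        obtain ⟨π₃, h3, hle⟩ := hπ.glue hπ' (hmem _ _ hE) (FM_mem x₀ α hα) hμ₀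
        have h4 := hlow _ _ _ hE h3
        have h5 := mul_le_mul_of_nonneg_left hle hL
        rw [← mul_add]
        refine mul_nonneg hs ?_
        linarith)
    (by
      intro v
      obtain ⟨α, β, rfl⟩ := FR_split v
      obtain ⟨s, hs, α', hα', e1⟩ := FM_normalize x₀ α
      obtain ⟨t, ht, β', hβ', e2⟩ := FM_normalize x₀ β
      obtain ⟨l, y, hE⟩ := hne
      have := (hmem _ _ hE).1
      refine ⟨_, ⟨α', l, y, _, hα', hE, Cpl.prod _ _, rfl⟩, _, ⟨β', _, hβ', Cpl.prod _ _, rfl⟩,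
        s, t, hs, ht, ?_⟩
      simp only
      rw [e1, e2, smul_neg, sub_eq_add_neg])
  refine ⟨fun x => l (Finsupp.single x 1), ?_, ?_⟩
  · intro α l' y π hα hE hπ
    rw [(FM_integral _ α).2 l (fun _ => rfl)]
    exact hlA _ ⟨α, l', y, π, hα, hE, hπ, rfl⟩
  · intro β π hβ hπ
    rw [(FM_integral _ β).2 l (fun _ => rfl)]
    have := hlB _ ⟨β, π, hβ, hπ, rfl⟩
    simp only [map_neg] at this
    linarith

lemma main_lip {x₀ : X} (E : Measure X → ℝ → Prop) (hmem : ∀ l y, E l y → MemP1 x₀ l)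
    (hconv : ∀ l y l' y' (t : ℝ), E l y → E l' y' → 0 ≤ t → t ≤ 1 →
      E ((ENNReal.ofReal t) • l + (ENNReal.ofReal (1 - t)) • l') (t * y + (1 - t) * y'))
    (hne : ∃ l y, E l y)
    {μ₀ : Measure X} (hμ₀ : MemP1 x₀ μ₀) {a L : ℝ} (hL : 0 ≤ L)
    (hlow : ∀ l y π, E l y → Cpl π l μ₀ → a ≤ y + L * ∫ p, dist p.1 p.2 ∂π) :
    ∃ f : X → ℝ, LipschitzWith L.toNNReal f ∧ (∀ l y, E l y → ∫ x, f x ∂l ≤ y) ∧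
      a ≤ ∫ x, f x ∂μ₀ := by
  obtain ⟨f, hf1, hf2⟩ := main_functional E hmem hconv hne hμ₀ hL hlow
  have := hμ₀.1
  have : Nonempty X := ⟨x₀⟩
  -- integral form on simple maps
  have hs1 : ∀ l y, E l y → ∀ T : SimpleFunc X X,
      ∫ x, f (T x) ∂l ≤ y + L * ∫ x, dist x (T x) ∂l := by
    intro l y hE T
    have := (hmem _ _ hE).1
    obtain ⟨α, hα⟩ := FM_simple l T
    obtain ⟨c1, c2⟩ := Cpl.map l (measurable_id (α := X)) T.measurable
    rw [Measure.map_id, ← hα] at c1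
    have := hf1 α l y _ (by rw [hα]; exact Measure.isProbabilityMeasure_map T.measurable.aemeasurable)
      hE c1
    have i := (FM_integral f α).1.aestronglyMeasurable
    rw [hα] at i
    rw [c2, hα, integral_map T.measurable.aemeasurable i] at this
    exact this
  have hs2 : ∀ T : SimpleFunc X X, a ≤ ∫ x, f (T x) ∂μ₀ + L * ∫ x, dist x (T x) ∂μ₀ := by
    intro T
    obtain ⟨α, hα⟩ := FM_simple μ₀ T
    obtain ⟨c1, c2⟩ := Cpl.map μ₀ T.measurable (measurable_id (α := X))
    rw [Measure.map_id, ← hα] at c1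
    have := hf2 α _ (by rw [hα]; exact Measure.isProbabilityMeasure_map T.measurable.aemeasurable)
      c1
    have i := (FM_integral f α).1.aestronglyMeasurable
    rw [hα] at i
    rw [c2, hα, integral_map T.measurable.aemeasurable i] at this
    simpa only [id, dist_comm] using this
  have hint : ∀ x, Integrable (fun z => dist x z) μ₀ := fun x =>
    hμ₀.lip (LipschitzWith.dist_right x)
  have hfl : ∀ x y, a - L * ∫ z, dist x z ∂μ₀ ≤ f y + L * dist x y := by
    intro x y
    have h := hs2 (SimpleFunc.const X y)
    simp only [SimpleFunc.const_apply, integral_const, probReal_univ, one_smul] at h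
    have h2 : ∫ z, dist z y ∂μ₀ ≤ ∫ z, (dist x z + dist x y) ∂μ₀ := by
      refine integral_mono ?_ ((hint x).add (integrable_const _)) fun z => ?_
      · simpa only [dist_comm] using hint y
      · exact dist_triangle_left _ _ _
    rw [integral_add (hint x) (integrable_const _)] at h2
    simp only [integral_const, probReal_univ, one_smul] at h2
    have := mul_le_mul_of_nonneg_left h2 hL
    linarith
  have hbdd : ∀ x, BddBelow (Set.range fun y => f y + L * dist x y) := fun x =>
    ⟨_, by rintro _ ⟨y, rfl⟩; exact hfl x y⟩
  let h : X → ℝ := fun x => ⨅ y, f y + L * dist x y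
  have hle : ∀ x y, h x ≤ f y + L * dist x y := fun x y => ciInf_le (hbdd x) y
  have hlip0 : ∀ x y, h x ≤ h y + L * dist x y := by
    intro x y
    rw [← sub_le_iff_le_add]
    refine le_ciInf fun z => ?_
    have h1 := hle x z
    have h2 := mul_le_mul_of_nonneg_left (dist_triangle x y z) hL
    linarith
  have hlip : LipschitzWith L.toNNReal h := by
    refine LipschitzWith.of_le_add_mul _ fun x y => ?_
    rw [Real.coe_toNNReal _ hL]; exact hlip0 x y
  have hhT : ∀ ν, MemP1 x₀ ν → ∀ T : SimpleFunc X X,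
      ∫ x, h x ∂ν ≤ ∫ x, h (T x) ∂ν + L * ∫ x, dist x (T x) ∂ν ∧
      ∫ x, h (T x) ∂ν ≤ ∫ x, h x ∂ν + L * ∫ x, dist x (T x) ∂ν := by
    intro ν hν T
    have i1 := hν.lip hlip
    have i2 := integrable_simple hν T h
    have i3 := (integrable_dist_simple hν T).const_mul L
    rw [← integral_const_mul, ← integral_add i2 i3, ← integral_add i1 i3]
    refine ⟨integral_mono i1 (i2.add i3) fun x => hlip0 _ _,
      integral_mono i2 (i1.add i3) fun x => ?_⟩
    have := hlip0 (T x) x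
    rwa [dist_comm] at this
  refine ⟨h, hlip, ?_, ?_⟩
  · intro l y hE
    have hl := hmem _ _ hE
    refine le_of_forall_pos_le_add fun ε hε => ?_
    obtain ⟨T, hT⟩ := approx_id hl (δ := ε / (2 * L + 1)) (by positivity)
    rw [lt_div_iff₀ (by positivity)] at hT
    have h1 := (hhT l hl T).1
    have h2 := hs1 l y hE T
    have h3 : ∫ x, h (T x) ∂l ≤ ∫ x, f (T x) ∂l :=
      integral_mono (integrable_simple hl T h) (integrable_simple hl T f) fun x => by
        have := hle (T x) (T x)
        simpa using this
    have h4 : 0 ≤ ∫ x, dist x (T x) ∂l := integral_nonneg fun _ => dist_nonneg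
    nlinarith
  · refine le_of_forall_pos_le_add fun ε hε => ?_
    obtain ⟨T, hT⟩ := approx_id hμ₀ (δ := ε / (2 * L + 1) / 2) (by positivity)
    rw [lt_div_iff₀ (by positivity), lt_div_iff₀ (by positivity)] at hT
    have hex : ∀ x, ∃ y, f y + L * dist x y < h x + ε / 2 := fun x =>
      exists_lt_of_ciInf_lt (lt_add_of_pos_right _ (by positivity))
    choose S hS using hex
    have h1 := (hhT μ₀ hμ₀ T).2
    have h2 := hs2 (T.map S)
    have i1 := integrable_simple hμ₀ (T.map S) f
    have i2 := (integrable_dist_simple hμ₀ (T.map S)).const_mul L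
    have i3 := (integrable_dist_simple hμ₀ T).const_mul L
    have i4 := integrable_simple hμ₀ T h
    rw [← integral_const_mul, ← integral_add i1 i2] at h2
    have h3 : ∫ x, (f (T.map S x) + L * dist x (T.map S x)) ∂μ₀ ≤
        ∫ x, ((h (T x) + L * dist x (T x)) + ε / 2) ∂μ₀ := by
      refine integral_mono (i1.add i2) ((i4.add i3).add (integrable_const _)) fun x => ?_
      have e1 := (hS (T x)).le
      have e2 := mul_le_mul_of_nonneg_left (dist_triangle x (T x) (S (T x))) hL
      simp only [SimpleFunc.map_apply]
      linarith
    have h5 : ∫ x, ((h (T x) + L * dist x (T x)) + ε / 2) ∂μ₀ =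
        ∫ x, h (T x) ∂μ₀ + L * ∫ x, dist x (T x) ∂μ₀ + ε / 2 := by
      have i5 : Integrable (fun x => h (T x) + L * dist x (T x)) μ₀ := i4.add i3
      rw [integral_add i5 (integrable_const _), integral_add i4 i3, integral_const_mul]
      simp
    have h4 : 0 ≤ ∫ x, dist x (T x) ∂μ₀ := integral_nonneg fun _ => dist_nonneg
    nlinarith

end

/-- Dual representation via the acceptance set: for proper convex `W₁`-lsc `φ`,
`φ(μ) = sup { ∫ f dμ : f Lipschitz, ∫ f dν ≤ φ(ν) for all ν ∈ P₁ }`. -/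
theorem stmt_16 {X : Type*} [MetricSpace X] [TopologicalSpace.SeparableSpace X]
    [CompleteSpace X] [MeasurableSpace X] [BorelSpace X] (x₀ : X)
    (φ : Measure X → EReal) (hbot : ∀ μ, MemP1 x₀ μ → φ μ ≠ ⊥)
    (hproper : ∃ μ, MemP1 x₀ μ ∧ φ μ ≠ ⊤)
    (hconv : ∀ μ, MemP1 x₀ μ → ∀ ν, MemP1 x₀ ν → ∀ t : ℝ, 0 ≤ t → t ≤ 1 →
      φ ((ENNReal.ofReal t) • μ + (ENNReal.ofReal (1 - t)) • ν) ≤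
        (t : EReal) * φ μ + ((1 - t : ℝ) : EReal) * φ ν)
    (hlsc : ∀ μ : ℕ → Measure X, (∀ n, MemP1 x₀ (μ n)) → ∀ ν, MemP1 x₀ ν →
      Filter.Tendsto (fun n => W1 (μ n) ν) Filter.atTop (nhds 0) →
      φ ν ≤ Filter.liminf (fun n => φ (μ n)) Filter.atTop) :
    ∀ μ, MemP1 x₀ μ →
      φ μ = ⨆ f : {f : X → ℝ // (∃ K : ℝ≥0, LipschitzWith K f) ∧
          ∀ ν, MemP1 x₀ ν → ((∫ x, f x ∂ν : ℝ) : EReal) ≤ φ ν},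
        ((∫ x, f.1 x ∂μ : ℝ) : EReal) := by
  intro μ₀ hμ₀
  haveI : SecondCountableTopology X := UniformSpace.secondCountable_of_separable X
  refine le_antisymm ?_ (iSup_le fun f => f.2.2 μ₀ hμ₀)
  let E : Measure X → ℝ → Prop := fun l y => MemP1 x₀ l ∧ φ l ≤ (y : EReal)
  have hmem : ∀ l y, E l y → MemP1 x₀ l := fun l y h => h.1
  have hconv' : ∀ l y l' y' (t : ℝ), E l y → E l' y' → 0 ≤ t → t ≤ 1 →
      E ((ENNReal.ofReal t) • l + (ENNReal.ofReal (1 - t)) • l') (t * y + (1 - t) * y') := by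
    rintro l y l' y' t ⟨m, h⟩ ⟨m', h'⟩ h0 h1
    refine ⟨m.mix m' h0 h1, (hconv l m l' m' t h0 h1).trans ?_⟩
    rw [EReal.coe_add, EReal.coe_mul, EReal.coe_mul]
    exact add_le_add (mul_le_mul_of_nonneg_left h (by exact_mod_cast h0))
      (mul_le_mul_of_nonneg_left h' (by exact_mod_cast sub_nonneg.2 h1))
  have hfin : ∀ l, MemP1 x₀ l → φ l ≠ ⊤ → φ l = ((φ l).toReal : EReal) := fun l hl ht =>
    (EReal.coe_toReal ht (hbot l hl)).symm
  have hne : ∃ l y, E l y := by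
    obtain ⟨l, hl, ht⟩ := hproper
    exact ⟨l, (φ l).toReal, hl, (hfin l hl ht).le⟩
  have hb : ∀ l, MemP1 x₀ l → ∃ b, ¬ E l b := by
    intro l hl
    obtain ⟨b, -, hb⟩ := EReal.lt_iff_exists_real_btwn.1 (bot_lt_iff_ne_bot.2 (hbot l hl))
    exact ⟨b, fun h => absurd h.2 (not_le.2 hb)⟩
  have hl : ∀ ν, MemP1 x₀ ν → ∀ a, ¬ E ν a → ∃ ε > 0, ∀ l y π, E l y → Cpl π l ν →
      ∫ p, dist p.1 p.2 ∂π < ε → a < y := by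
    intro ν hν a ha
    by_contra! hcon
    have hn : ∀ n : ℕ, (0 : ℝ) < 1 / ((n : ℝ) + 1) := fun n => by positivity
    choose l y π h1 h2 h3 h4 using fun n : ℕ => hcon _ (hn n)
    refine ha ⟨hν, ?_⟩
    refine (hlsc l (fun n => (h1 n).1) ν hν ?_).trans ?_
    · have hnn : ∀ n, ∀ c ∈ {c : ℝ | ∃ π : Measure (X × X), IsProbabilityMeasure π ∧
          π.map Prod.fst = l n ∧ π.map Prod.snd = ν ∧ c = ∫ p, dist p.1 p.2 ∂π}, 0 ≤ c := by
        rintro n c ⟨π, -, -, -, rfl⟩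
        exact cost_nonneg π
      refine squeeze_zero (fun n => Real.sInf_nonneg (hnn n)) (fun n => ?_)
        tendsto_one_div_add_atTop_nhds_zero_nat
      exact (csInf_le ⟨0, hnn n⟩ ⟨π n, (h2 n).1, (h2 n).2.1, (h2 n).2.2, rfl⟩).trans (h3 n).le
    · refine (Filter.liminf_le_liminf (v := fun _ => (a : EReal))
        (Filter.Eventually.of_forall fun n => (h1 n).2.trans ?_)).trans ?_
      · exact_mod_cast h4 n
      · simp
  refine le_of_forall_lt fun c hc => ?_
  obtain ⟨a, hca, ha⟩ := EReal.lt_iff_exists_real_btwn.1 hc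
  obtain ⟨L, hL, hlow⟩ := low_bound E hmem hconv' hne hb hl hμ₀ (a := a)
    (fun h => absurd h.2 (not_le.2 ha))
  obtain ⟨f, hf1, hf2, hf3⟩ := main_lip E hmem hconv' hne hμ₀ hL hlow
  refine hca.trans_le (le_trans (EReal.coe_le_coe_iff.2 hf3) ?_)
  refine le_iSup (fun f : {f : X → ℝ // (∃ K : ℝ≥0, LipschitzWith K f) ∧
          ∀ ν, MemP1 x₀ ν → ((∫ x, f x ∂ν : ℝ) : EReal) ≤ φ ν} => ((∫ x, f.1 x ∂μ₀ : ℝ) : EReal))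
    ⟨f, ⟨_, hf1⟩, fun ν hν => ?_⟩
  by_cases ht : φ ν = ⊤
  · rw [ht]; exact le_top
  · rw [hfin ν hν ht]
    exact EReal.coe_le_coe_iff.2 (hf2 ν _ ⟨hν, (hfin ν hν ht).le⟩)
end
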